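/- Let g ≥ 1, n ≥ 1, and let d_1,…,d_n ≥ 0 be integers with Σ_{j=1}^n d_j = g+n−2. Then ⟨τ_{2g} Π_{j=1}^n τ_{d_j}⟩_g = Σ_{j=1}^{n} ⟨τ_{d_j+2g−1} Π_{i≠j} τ_{d_i}⟩_g − (1/2) Σ_{g'=0}^{g} Σ_{{1,…,n}=I⊔J} Σ_{j=0}^{2g−2} (−1)^j ⟨τ_{j} Π_{i∈I} τ_{d_i}⟩_{g'} ⟨τ_{2g−2−j} Π_{i∈J} τ_{d_i}⟩_{g−g'}, where the sum over I⊔J runs over ordered pairs of disjoint, possibly empty, sets with union {1,…,n}. -/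

import Mathlib

open MvPolynomial Finset

noncomputable section

/-- The polynomial ring `ℚ[x_1,…,x_n]`. -/
abbrev R (n : ℕ) : Type := MvPolynomial (Fin n) ℚ

/-- The field of rational functions `ℚ(x_1,…,x_n)`. -/
abbrev K (n : ℕ) : Type := FractionRing (R n)

/-- `x_1 + ⋯ + x_n` as an element of `K n`. -/
def SX (n : ℕ) : K n := algebraMap (R n) (K n) (∑ j, X j)

/-- `x_1^3 + ⋯ + x_n^3` as an element of `K n`. -/
def SX3 (n : ℕ) : K n := algebraMap (R n) (K n) (∑ j, (X j)^3)

/-- `Δ(x_1,…,x_n) = ((Σ x_j)^3 − Σ x_j^3)/3`. -/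
def Dlt (n : ℕ) : K n := ((SX n)^3 - SX3 n) / 3

/-- The ring homomorphism `ℚ[x_1,…,x_{|I|}] → ℚ(x_1,…,x_n)` substituting the variables
of the subset `I` (in increasing order). -/
def embRH {n : ℕ} (I : Finset (Fin n)) : R I.card →+* K n :=
  (algebraMap (R n) (K n)).comp
    (MvPolynomial.rename (fun i : Fin I.card => ((I.orderIsoOfFin rfl) i : Fin n))).toRingHom

lemma embRH_inj {n : ℕ} (I : Finset (Fin n)) : Function.Injective (embRH I) := by
  have h1 : Function.Injective (fun i : Fin I.card => ((I.orderIsoOfFin rfl) i : Fin n)) := by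
    intro i j hij
    exact (I.orderIsoOfFin rfl).injective (Subtype.val_injective hij)
  have h2 := (IsFractionRing.injective (R n) (K n)).comp (MvPolynomial.rename_injective _ h1)
  simpa [embRH, RingHom.coe_comp] using h2

/-- The field embedding `ℚ(x_1,…,x_{|I|}) → ℚ(x_1,…,x_n)` substituting the variables
of the subset `I` (in increasing order).  Used for expressions like `G_{r'}(x_I)`. -/
def emb {n : ℕ} (I : Finset (Fin n)) : K I.card →+* K n :=
  IsFractionRing.lift (embRH_inj I)

/-- The normalized `n`-point functions `G_g(x_1,…,x_n)`, defined with a fuel parameter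
(first argument) for structural recursion; for `fuel ≥ n` this computes the recursively
defined normalized `n`-point function:  `G_0(x) = x^{-2}`, `G_g(x) = 0` for `g ≥ 1`, and
for `n ≥ 2`,
`G_g = Σ_{r+s=g} ((2r+n−3)!!/(4^s(2r+2s+n−1)!!)) P_r Δ^s` where
`P_r = (1/(2Σx_j)) Σ_{I⊔J={1..n}, I,J≠∅} (Σ_I x)²(Σ_J x)² Σ_{r'≤r} G_{r'}(x_I)G_{r−r'}(x_J)`. -/
def Gf : (fuel : ℕ) → (n : ℕ) → ℕ → K n
  | _, 0, _ => 0
  | _, 1, 0 => (algebraMap (R 1) (K 1) (X 0)) ^ (-2 : ℤ)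
  | _, 1, _+1 => 0
  | 0, _+2, _ => 0
  | fuel+1, n+2, g =>
      ∑ s ∈ Finset.range (g+1),
        (((Nat.doubleFactorial (2*(g-s)+(n+2)-3) : ℚ) /
          (4^s * (Nat.doubleFactorial (2*g+(n+2)-1) : ℚ))) : K (n+2)) *
        ((2 * SX (n+2))⁻¹ *
          ∑ I : Finset (Fin (n+2)),
            if I ≠ ∅ ∧ I ≠ univ then
              (algebraMap (R (n+2)) (K (n+2)) (∑ i ∈ I, X i))^2 *
              (algebraMap (R (n+2)) (K (n+2)) (∑ i ∈ Iᶜ, X i))^2 *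
              ∑ r' ∈ Finset.range ((g-s)+1),
                emb I (Gf fuel I.card r') * emb Iᶜ (Gf fuel Iᶜ.card ((g-s) - r'))
            else 0) *
        (Dlt (n+2))^s

/-- The normalized `n`-point function `G_g(x_1,…,x_n)` as an element of `ℚ(x_1,…,x_n)`. -/
def Gnpt (n g : ℕ) : K n := Gf n n g

/-- `P_r(x_1,…,x_n)`. -/
def Ppoly (n r : ℕ) : K n :=
  (2 * SX n)⁻¹ *
    ∑ I : Finset (Fin n),
      if I ≠ ∅ ∧ I ≠ univ then
        (algebraMap (R n) (K n) (∑ i ∈ I, X i))^2 *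
        (algebraMap (R n) (K n) (∑ i ∈ Iᶜ, X i))^2 *
        ∑ r' ∈ Finset.range (r+1), emb I (Gnpt I.card r') * emb Iᶜ (Gnpt Iᶜ.card (r - r'))
      else 0

/-- The `n`-point function `F_g(x_1,…,x_n) = Σ_{h+d=g} (1/d!)((Σx_j^3)/24)^d G_h(x_1,…,x_n)`. -/
def Fnpt (n g : ℕ) : K n :=
  ∑ d ∈ Finset.range (g+1),
    ((1 / (Nat.factorial d : ℚ)) : K n) * (SX3 n / 24)^d * Gnpt n (g-d)

open Classical in
/-- The coefficient of the monomial `Π x_j^{d_j}` of an element of `ℚ(x_1,…,x_n)` which is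
a polynomial (junk value `0` otherwise). -/
def coeffK {n : ℕ} (f : K n) (d : Fin n → ℕ) : ℚ :=
  if h : ∃ p : R n, algebraMap (R n) (K n) p = f then
    MvPolynomial.coeff (Finsupp.equivFunOnFinite.symm d) h.choose
  else 0

/-- The intersection index `⟨τ_{d_1} ⋯ τ_{d_n}⟩_g`, i.e. the coefficient of `Π x_j^{d_j}`
in `F_g(x_1,…,x_n)`.  For `(g,n) = (0,1), (0,2)` and nonnegative `d_j` the value is `0`
(the conventional values `⟨τ_{-2}⟩_0 = 1`, `⟨τ_k τ_{-1-k}⟩_0 = (-1)^k` have a negative index). -/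
def bracket (g : ℕ) {n : ℕ} (d : Fin n → ℕ) : ℚ :=
  if g = 0 ∧ n ≤ 2 then 0 else coeffK (Fnpt n g) d

/-- `⟨τ_j Π_{i ∈ I} τ_{d_i}⟩_g` for a subset `I ⊆ {1,…,n}`. -/
def bracketI (g : ℕ) {n : ℕ} (j : ℕ) (I : Finset (Fin n)) (d : Fin n → ℕ) : ℚ :=
  bracket g (Fin.cons j (fun i : Fin I.card => d ((I.orderIsoOfFin rfl) i)))


/-! ### Laurent expansions in `y` (formal series in `ℚ[x_1,…,x_n][[y,y⁻¹]]` of bounded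
`y`-degree, realized as Hahn/Laurent series in the variable `t = y⁻¹`, so that the
coefficient of `y^k` is the Hahn coefficient at `-k`). -/

/-- Laurent series in `t = y⁻¹` with coefficients in `ℚ[x_1,…,x_n]`. -/
abbrev Lau (n : ℕ) : Type := LaurentSeries (R n)

/-- The generalized binomial coefficient `C(p,k) = p(p−1)⋯(p−k+1)/k!` for `p : ℤ`, `k : ℕ`. -/
def binomZ (p : ℤ) (k : ℕ) : ℚ := (∏ i ∈ Finset.range k, ((p : ℚ) - i)) / (Nat.factorial k)

/-- The expansion of `(y + c)^m = Σ_{k≥0} C(m,k) c^k y^{m−k}` as a Laurent series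
in `t = y⁻¹` (for `m ≥ 0` this is the usual binomial expansion of the polynomial). -/
def yExpAdd {n : ℕ} (c : R n) (m : ℤ) : Lau n :=
  (HahnSeries.single (-m) (1 : R n)) *
    HahnSeries.ofPowerSeries ℤ (R n)
      (PowerSeries.mk fun k => MvPolynomial.C (binomZ m k) * c^k)

/-- The expansion of `(±y + c)^m`, where the sign is `+` if `σ = true` and `−` otherwise;
it is computed as `(±1)^m (y ± c)^m`. -/
def LExp {n : ℕ} (σ : Bool) (c : R n) (m : ℤ) : Lau n :=
  (if σ then 1 else if Even m then 1 else -1 : Lau n) *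
    yExpAdd ((if σ then 1 else -1 : R n) * c) m

open Classical in
/-- The polynomial representing an element of `ℚ(x_1,…,x_n)` lying in `ℚ[x_1,…,x_n]`
(junk value `0` otherwise). -/
def polyOf {n : ℕ} (f : K n) : R n :=
  if h : ∃ p : R n, algebraMap (R n) (K n) p = f then h.choose else 0

/-- `±y` as a Laurent series in `t = y⁻¹`. -/
def yLau (n : ℕ) (σ : Bool) : Lau n :=
  (if σ then 1 else -1 : Lau n) * HahnSeries.single (-1 : ℤ) (1 : R n)

/-- The expansion of `F_g(±y, x_I)` as a Laurent series in `t = y⁻¹` with coefficients in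
`ℚ[x_1,…,x_n]`: for `(g,|I|+1) = (0,1)` it is `(±y)^{-2} = y^{-2}`, for `(g,|I|+1) = (0,2)`
it is `1/(±y + x_i) = Σ_{k≥0} (−1)^k x_i^k (±y)^{−k−1}`, and otherwise it is obtained by
substituting `±y` and the variables of `I` into the polynomial `F_g`. -/
def FExp {n : ℕ} (σ : Bool) (g : ℕ) (I : Finset (Fin n)) : Lau n :=
  if g = 0 ∧ I.card = 0 then HahnSeries.single (2 : ℤ) (1 : R n)
  else if g = 0 ∧ I.card = 1 then LExp σ (∑ i ∈ I, X i) (-1)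
  else
    MvPolynomial.eval₂ ((HahnSeries.C).comp (algebraMap ℚ (R n)))
      (Fin.cons (yLau n σ)
        (fun i : Fin I.card => HahnSeries.C (X ((I.orderIsoOfFin rfl) i : Fin n))))
      (polyOf (Fnpt (I.card + 1) g))

/-- `L_g^{a,b}(y, x_1,…,x_n) = Σ_{g'=0}^{g} Σ_{I⊔J={1,…,n}} (y+Σ_I x)^a (−y+Σ_J x)^b
F_{g'}(y,x_I) F_{g−g'}(−y,x_J)` as a Laurent series in `t = y⁻¹`. -/
def LL (g n : ℕ) (a b : ℤ) : Lau n :=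
  ∑ gp ∈ Finset.range (g+1), ∑ I : Finset (Fin n),
    LExp true (∑ i ∈ I, X i) a * LExp false (∑ i ∈ Iᶜ, X i) b *
      FExp true gp I * FExp false (g - gp) Iᶜ

/-- The coefficient of `y^k Π_j x_j^{d_j}` in a Laurent series in `t = y⁻¹` with coefficients
in `ℚ[x_1,…,x_n]`. -/
def coeffL {n : ℕ} (f : Lau n) (k : ℤ) (d : Fin n → ℕ) : ℚ :=
  MvPolynomial.coeff (Finsupp.equivFunOnFinite.symm d) (f.coeff (-k))

/-- The index of the variable `z_i` among the `a + b + n` variables `z, w, x`. -/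
def zIdx (a b n : ℕ) (i : Fin a) : Fin (a+b+n) := ⟨i.1, by have := i.2; omega⟩

/-- The index of the variable `w_i` among the `a + b + n` variables `z, w, x`. -/
def wIdx (a b n : ℕ) (i : Fin b) : Fin (a+b+n) := ⟨a + i.1, by have := i.2; omega⟩

/-- The index of the variable `x_i` among the `a + b + n` variables `z, w, x`. -/
def xIdx (a b n : ℕ) (i : Fin n) : Fin (a+b+n) := ⟨a + b + i.1, by have := i.2; omega⟩

/-- `L_g(y; z_1,…,z_a; w_1,…,w_b; x_1,…,x_n)
 = Σ_{g'=0}^{g} Σ_{I⊔J={1,…,n}} F_{g'}(y, z, x_I) F_{g−g'}(−y, w, x_J)`,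
as a Laurent series in `t = y⁻¹` with coefficients in `ℚ[z,w,x]`. -/
def LLm (g n a b : ℕ) : Lau (a+b+n) :=
  ∑ gp ∈ Finset.range (g+1), ∑ I : Finset (Fin n),
    FExp true gp ((univ.image (zIdx a b n)) ∪ I.image (xIdx a b n)) *
    FExp false (g - gp) ((univ.image (wIdx a b n)) ∪ Iᶜ.image (xIdx a b n))

/-- The exponent vector of the monomial `Π z_j^{r_j} Π w_j^{s_j} Π x_j^{d_j}`. -/
def expVec (a b n : ℕ) (r : Fin a → ℕ) (s : Fin b → ℕ) (d : Fin n → ℕ) :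
    Fin (a+b+n) → ℕ :=
  fun v =>
    if h : v.1 < a then r ⟨v.1, h⟩
    else if h2 : v.1 < a + b then s ⟨v.1 - a, by omega⟩
    else d ⟨v.1 - (a+b), by have := v.2; omega⟩


section Euler

variable {A : Type*} [CommRing A]

/-- The Euler operator `f ↦ X · f'` on formal power series. -/
def eulerOp (f : PowerSeries A) : PowerSeries A := PowerSeries.X * PowerSeries.derivative A f

lemma coeff_eulerOp (f : PowerSeries A) (g : ℕ) :
    PowerSeries.coeff g (eulerOp f) = g * PowerSeries.coeff g f := by
  cases g with
  | zero => simp [eulerOp]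
  | succ g => simp [eulerOp, PowerSeries.coeff_succ_X_mul, PowerSeries.coeff_derivative, mul_comm]

lemma eulerOp_mul (f h : PowerSeries A) :
    eulerOp (f * h) = eulerOp f * h + f * eulerOp h := by
  simp only [eulerOp, Derivation.leibniz, smul_eq_mul]; ring

lemma eulerOp_sum {κ : Type*} (s : Finset κ) (f : κ → PowerSeries A) :
    eulerOp (∑ i ∈ s, f i) = ∑ i ∈ s, eulerOp (f i) := by
  simp [eulerOp, Finset.mul_sum]

lemma eulerOp_C_mul (a : A) (f : PowerSeries A) :
    eulerOp (PowerSeries.C a * f) = PowerSeries.C a * eulerOp f := by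
  ext g; simp [coeff_eulerOp, PowerSeries.coeff_C_mul]; ring

lemma map_eulerOp {B : Type*} [CommRing B] (φ : A →+* B) (f : PowerSeries A) :
    PowerSeries.map φ (eulerOp f) = eulerOp (PowerSeries.map φ f) := by
  ext g; simp [coeff_eulerOp]

end Euler

section SubsetSums

variable {ι M : Type*} [DecidableEq ι] [AddCommMonoid M]

lemma sum_powerset_sdiff (s : Finset ι) (f : Finset ι → Finset ι → M) :
    ∑ I ∈ s.powerset, f I (s \ I) = ∑ I ∈ s.powerset, f (s \ I) I := by
  refine Finset.sum_bij' (fun I _ => s \ I) (fun I _ => s \ I) ?_ ?_ ?_ ?_ ?_ <;>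
    simp +contextual [Finset.sdiff_subset]

lemma sum_powerset_powerset (s : Finset ι) (f : Finset ι → Finset ι → Finset ι → M) :
    ∑ I ∈ s.powerset, ∑ K ∈ I.powerset, f K (I \ K) (s \ I)
      = ∑ K ∈ s.powerset, ∑ I ∈ (s \ K).powerset, f K I ((s \ K) \ I) := by
  rw [Finset.sum_sigma', Finset.sum_sigma']
  refine Finset.sum_bij' (fun p _ => ⟨p.2, p.1 \ p.2⟩) (fun p _ => ⟨p.1 ∪ p.2, p.1⟩) ?_ ?_ ?_ ?_ ?_
  · rintro ⟨I, K⟩ h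
    simp only [mem_sigma, mem_powerset] at h ⊢
    exact ⟨h.2.trans h.1, Finset.sdiff_subset_sdiff h.1 le_rfl⟩
  · rintro ⟨I, K⟩ h
    simp only [mem_sigma, mem_powerset] at h ⊢
    exact ⟨Finset.union_subset h.1 (h.2.trans Finset.sdiff_subset), Finset.subset_union_left⟩
  · rintro ⟨I, K⟩ h
    simp only [mem_sigma, mem_powerset] at h
    simp [Finset.union_sdiff_of_subset h.2]
  · rintro ⟨K, I⟩ h
    simp only [mem_sigma, mem_powerset] at h
    have : Disjoint K I := (Finset.disjoint_sdiff).mono_right h.2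
    simp [Finset.union_sdiff_cancel_left this]
  · rintro ⟨I, K⟩ h
    simp only [mem_sigma, mem_powerset] at h
    dsimp only
    congr 1
    rw [_root_.sdiff_sdiff_left, Finset.sup_eq_union, Finset.union_sdiff_of_subset h.2]

omit [DecidableEq ι] in
lemma sum_powerset_map {κ : Type*} [DecidableEq κ] (e : ι ↪ κ) (s : Finset ι)
    (f : Finset κ → M) :
    ∑ I ∈ (s.map e).powerset, f I = ∑ I ∈ s.powerset, f (I.map e) := by
  symm
  refine Finset.sum_bij (fun I _ => I.map e) ?_ ?_ ?_ ?_
  · intro I hI; simpa using hI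
  · intro I _ J _ h; exact Finset.map_injective e h
  · intro I hI
    rw [mem_powerset, Finset.subset_map_iff] at hI
    obtain ⟨J, hJ, rfl⟩ := hI
    exact ⟨J, by simpa using hJ, rfl⟩
  · intro _ _; rfl

end SubsetSums

section Series

variable {A : Type*} [CommRing A] [Algebra ℚ A] {ι : Type*} [DecidableEq ι]

/-- The solution `u` of `(2g + k) u_g = c u_{g-1} + f_g`, with `u_0 = 1` if `k = 0`. -/
def odeSol (k : ℕ) (c : A) (f : ℕ → A) : ℕ → A
  | 0 => if k = 0 then 1 else algebraMap ℚ A (1 / k) * f 0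
  | g + 1 => algebraMap ℚ A (1 / (2 * (g + 1) + k)) * (c * odeSol k c f g + f (g + 1))

/-- The series `∑_g (∑_{i ∈ s} x_i)² F_g(x_s) ħ^g`, which has polynomial coefficients. -/
def useries (x : ι → A) (s : Finset ι) : PowerSeries A :=
  if s = ∅ then 0 else
    PowerSeries.mk (odeSol (s.card - 1) (algebraMap ℚ A (1 / 12) * (∑ i ∈ s, x i) ^ 3)
      fun g => algebraMap ℚ A (1 / 2) * (∑ i ∈ s, x i) *
        PowerSeries.coeff g (∑ I ∈ {I ∈ s.ssubsets | I ≠ ∅}.attach,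
          useries x I.1 * useries x (s \ I.1)))
termination_by s.card
decreasing_by
  · have h := I.2
    simp only [mem_filter, mem_ssubsets] at h
    exact Finset.card_lt_card h.1
  · have h := I.2
    simp only [mem_filter, mem_ssubsets] at h
    refine Finset.card_lt_card (Finset.sdiff_ssubset h.1.1 ?_)
    exact Finset.nonempty_iff_ne_empty.2 h.2

@[simp] lemma useries_empty (x : ι → A) : useries x ∅ = 0 := by
  rw [useries]; simp

lemma isUnit_natCast_of_ne_zero {k : ℕ} (hk : k ≠ 0) : IsUnit (k : A) := by
  have : (k : A) = algebraMap ℚ A k := by simp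
  rw [this]
  exact (isUnit_iff_ne_zero.2 (by exact_mod_cast hk)).map _

/-- The quadratic differential equation satisfied by the series `useries x s`. -/
def QuadEq (x : ι → A) (v : Finset ι → PowerSeries A) (s : Finset ι) : Prop :=
  12 * (2 * eulerOp (v s) + ((s.card : PowerSeries A) - 1) * v s)
    = PowerSeries.C ((∑ i ∈ s, x i) ^ 3) * PowerSeries.X * v s
      + 6 * PowerSeries.C (∑ i ∈ s, x i) * ∑ I ∈ s.powerset, v I * v (s \ I)

omit [Algebra ℚ A] in
lemma sum_powerset_mul_eq_sum_attach (v : Finset ι → PowerSeries A) (hv : v ∅ = 0)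
    (s : Finset ι) :
    ∑ I ∈ s.powerset, v I * v (s \ I)
      = ∑ I ∈ {I ∈ s.ssubsets | I ≠ ∅}.attach, v I.1 * v (s \ I.1) := by
  rw [Finset.sum_attach _ (fun I => v I * v (s \ I))]
  symm
  apply Finset.sum_subset
  · intro I
    simp only [mem_filter, mem_ssubsets, mem_powerset]
    exact fun h => h.1.1
  · intro I hI hI'
    rw [mem_powerset] at hI
    simp only [mem_filter, mem_ssubsets, not_and, not_not] at hI'
    by_cases h : I = s
    · subst h; simp [hv]
    · rw [hI' (lt_of_le_of_ne hI h), hv, zero_mul]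

omit [Algebra ℚ A] [DecidableEq ι] in
lemma coeff_natCast_mul (k : ℕ) (g : ℕ) (f : PowerSeries A) :
    PowerSeries.coeff g ((k : PowerSeries A) * f) = k * PowerSeries.coeff g f := by
  have : (k : PowerSeries A) = PowerSeries.C (k : A) := by simp
  rw [this, PowerSeries.coeff_C_mul]

omit [Algebra ℚ A] in
lemma quadEq_iff_coeff {x : ι → A} {v : Finset ι → PowerSeries A} {s : Finset ι} :
    QuadEq x v s ↔ ∀ g : ℕ,
    12 * ((2 * g + ((s.card : A) - 1)) * PowerSeries.coeff g (v s))
      = (∑ i ∈ s, x i) ^ 3 * (if g = 0 then 0 else PowerSeries.coeff (g - 1) (v s))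
        + 6 * (∑ i ∈ s, x i) * PowerSeries.coeff g (∑ I ∈ s.powerset, v I * v (s \ I)) := by
  rw [QuadEq, PowerSeries.ext_iff]
  refine forall_congr' fun g => ?_
  have h12 : (12 : PowerSeries A) = ((12 : ℕ) : PowerSeries A) := by norm_num
  have h2 : (2 : PowerSeries A) = ((2 : ℕ) : PowerSeries A) := by norm_num
  have h6 : (6 : PowerSeries A) = ((6 : ℕ) : PowerSeries A) := by norm_num
  rw [h12, h2, h6, sub_mul, one_mul, mul_assoc, mul_assoc]
  simp only [map_add, map_sub, coeff_natCast_mul, coeff_eulerOp, PowerSeries.coeff_C_mul]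
  have : PowerSeries.coeff g (PowerSeries.X * v s)
      = if g = 0 then 0 else PowerSeries.coeff (g - 1) (v s) := by
    cases g <;> simp [PowerSeries.coeff_succ_X_mul]
  rw [this]
  push_cast
  constructor <;> intro h <;> linear_combination h

lemma useries_quadEq (x : ι → A) (s : Finset ι) : QuadEq x (useries x) s := by
  rcases Finset.eq_empty_or_nonempty s with rfl | hs
  · simp [QuadEq, eulerOp]
  rw [quadEq_iff_coeff, sum_powerset_mul_eq_sum_attach _ (useries_empty x)]
  have hc : 1 ≤ s.card := Finset.card_pos.2 hs
  obtain ⟨k, hk⟩ : ∃ k, s.card = k + 1 := ⟨s.card - 1, by omega⟩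
  intro g
  rw [useries, if_neg hs.ne_empty]
  simp only [PowerSeries.coeff_mk]
  set f := fun g => algebraMap ℚ A (1 / 2) * (∑ i ∈ s, x i) *
        PowerSeries.coeff g (∑ I ∈ {I ∈ s.ssubsets | I ≠ ∅}.attach,
          useries x I.1 * useries x (s \ I.1)) with hf
  have hf' : ∀ g, 6 * (∑ i ∈ s, x i) * PowerSeries.coeff g (∑ I ∈ {I ∈ s.ssubsets | I ≠ ∅}.attach,
          useries x I.1 * useries x (s \ I.1)) = 12 * f g := by
    intro g
    have : (6 : A) = 12 * algebraMap ℚ A (1/2) := by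
      rw [show (12 : A) = algebraMap ℚ A 12 from (map_ofNat _ _).symm, ← map_mul,
        ← map_ofNat (algebraMap ℚ A) 6]; norm_num
    rw [hf, this]; ring
  rw [hf' g]
  simp only [hk, Nat.add_sub_cancel, Nat.cast_add, Nat.cast_one, add_sub_cancel_right]
  have h12 : (12 : A) * algebraMap ℚ A (1 / 12) = 1 := by
    rw [show (12 : A) = algebraMap ℚ A 12 from (map_ofNat _ _).symm, ← map_mul]; norm_num
  cases g with
  | zero =>
    rcases Nat.eq_zero_or_pos k with rfl | hkp
    · have hempty : ({I ∈ s.ssubsets | I ≠ ∅} : Finset (Finset ι)) = ∅ := by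
        rw [Finset.filter_eq_empty_iff]
        intro I hI
        have := Finset.card_lt_card (mem_ssubsets.1 hI)
        simp only [not_not]
        exact Finset.card_eq_zero.1 (by omega)
      simp [odeSol, hf]
      rw [hempty]; simp
    · have : (k : A) * algebraMap ℚ A (1 / k) = 1 := by
        rw [show (k : A) = algebraMap ℚ A k by simp, ← map_mul]
        rw [mul_one_div_cancel (by positivity), map_one]
      simp only [odeSol, if_neg hkp.ne', if_true, Nat.cast_zero]
      linear_combination 12 * f 0 * this
  | succ g =>
    have : (2 * ((g : A) + 1) + k) * algebraMap ℚ A (1 / (2 * (g + 1) + k)) = 1 := by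
      rw [show (2 * ((g : A) + 1) + k) = algebraMap ℚ A (2 * (g + 1) + k) by
        simp [map_ofNat], ← map_mul]
      rw [mul_one_div_cancel (by positivity), map_one]
    simp only [odeSol, Nat.succ_ne_zero, if_false, Nat.add_sub_cancel, Nat.cast_add, Nat.cast_one]
    linear_combination 12 * (algebraMap ℚ A (1 / 12) * (∑ i ∈ s, x i) ^ 3 * 
      odeSol k (algebraMap ℚ A (1 / 12) * (∑ i ∈ s, x i) ^ 3) f g + f (g+1)) * this
      + (∑ i ∈ s, x i) ^ 3 * odeSol k (algebraMap ℚ A (1 / 12) * (∑ i ∈ s, x i) ^ 3) f g * h12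

lemma coeff_zero_useries_singleton (x : ι → A) (i : ι) :
    PowerSeries.coeff 0 (useries x {i}) = 1 := by
  rw [useries]; simp [odeSol]

/-- A family is determined at `s` by the quadratic equation and its values at smaller sets. -/
lemma eq_useries_of_quadEq {x : ι → A} {v : Finset ι → PowerSeries A} {s : Finset ι}
    (hs : s.Nonempty) (h0 : v ∅ = 0) (h1 : s.card = 1 → PowerSeries.coeff 0 (v s) = 1)
    (hlt : ∀ I, I ⊂ s → v I = useries x I) (h : QuadEq x v s) : v s = useries x s := by
  have hsum : ∑ I ∈ s.powerset, v I * v (s \ I)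
      = ∑ I ∈ s.powerset, useries x I * useries x (s \ I) := by
    refine Finset.sum_congr rfl fun I hI => ?_
    rw [mem_powerset] at hI
    by_cases hIs : I = s
    · subst hIs; simp [h0]
    rcases Finset.eq_empty_or_nonempty I with rfl | hne
    · simp [h0]
    · rw [hlt I (lt_of_le_of_ne hI hIs), hlt _ (Finset.sdiff_ssubset hI hne)]
  have h' := useries_quadEq x s
  rw [quadEq_iff_coeff] at h h'
  ext g
  induction g with
  | zero =>
    by_cases hc : s.card = 1
    · obtain ⟨i, rfl⟩ := Finset.card_eq_one.1 hc
      rw [h1 hc, coeff_zero_useries_singleton]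
    · have := h 0
      have h2 := h' 0
      rw [hsum] at this
      have hu : IsUnit ((12 * (s.card - 1) : ℕ) : A) := isUnit_natCast_of_ne_zero (by
        have := Finset.card_pos.2 hs; omega)
      apply hu.mul_left_cancel
      have hcast : ((12 * (s.card - 1) : ℕ) : A) = 12 * ((s.card : A) - 1) := by
        rw [Nat.cast_mul, Nat.cast_sub (Finset.card_pos.2 hs)]; norm_num
      rw [hcast]
      simp only [if_true, Nat.cast_zero] at this h2
      linear_combination this - h2
  | succ g ih =>
    have := h (g + 1)
    have h2 := h' (g + 1)
    rw [hsum] at this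
    have hu : IsUnit ((12 * (2 * (g + 1) + (s.card - 1)) : ℕ) : A) :=
      isUnit_natCast_of_ne_zero (by omega)
    apply hu.mul_left_cancel
    have hcast : ((12 * (2 * (g + 1) + (s.card - 1)) : ℕ) : A)
        = 12 * (2 * ((g : A) + 1) + ((s.card : A) - 1)) := by
      push_cast [Nat.cast_sub (Finset.card_pos.2 hs)]; norm_num
    rw [hcast]
    simp only [Nat.succ_ne_zero, if_false, Nat.add_sub_cancel, Nat.cast_add, Nat.cast_one, ih]
      at this h2
    linear_combination this - h2

lemma eq_useries {x : ι → A} {v : Finset ι → PowerSeries A} (h0 : v ∅ = 0)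
    (h1 : ∀ i, PowerSeries.coeff 0 (v {i}) = 1) (h : ∀ s, QuadEq x v s) (s : Finset ι) :
    v s = useries x s := by
  induction s using Finset.strongInduction with
  | H s ih =>
    rcases Finset.eq_empty_or_nonempty s with rfl | hs
    · simp [h0]
    · refine eq_useries_of_quadEq hs h0 (fun hc => ?_) ih (h s)
      obtain ⟨i, rfl⟩ := Finset.card_eq_one.1 hc
      exact h1 i

lemma map_useries {B : Type*} [CommRing B] [Algebra ℚ B] (φ : A →+* B) (x : ι → A)
    (s : Finset ι) : PowerSeries.map φ (useries x s) = useries (fun i => φ (x i)) s := by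
  refine eq_useries (v := fun s => PowerSeries.map φ (useries x s)) (by simp) (fun i => ?_)
    (fun s => ?_) s
  · rw [PowerSeries.coeff_map, coeff_zero_useries_singleton, map_one]
  · have := congrArg (PowerSeries.map φ) (useries_quadEq x s)
    simp only [map_add, map_mul, map_sub, map_sum, map_eulerOp, map_ofNat, map_natCast, map_one,
      PowerSeries.map_C, PowerSeries.map_X, map_pow] at this
    simpa only [QuadEq, map_sum, map_pow] using this

lemma useries_comp {κ : Type*} [DecidableEq κ] (e : ι ↪ κ) (x : κ → A) (s : Finset ι) :
    useries (fun i => x (e i)) s = useries x (s.map e) := by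
  symm
  refine eq_useries (v := fun s => useries x (s.map e)) (by simp) (fun i => ?_)
    (fun s => ?_) s
  · simp [-PowerSeries.coeff_zero_eq_constantCoeff, coeff_zero_useries_singleton]
  · have := useries_quadEq x (s.map e)
    rw [QuadEq, sum_powerset_map] at this
    simpa only [QuadEq, Finset.sum_map, Finset.card_map, Finset.map_sdiff] using this

end Series

section Division

variable {A : Type*} [CommRing A] [Algebra ℚ A] {ι : Type*} [DecidableEq ι]

omit [Algebra ℚ A] in
/-- `∑ S_K U_K U_L U_M` over ordered decompositions of `s` gives `(S/3) ∑ U_K U_L U_M`. -/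
lemma three_mul_sum_sum_eq (x : ι → A) (u : Finset ι → PowerSeries A) (s : Finset ι) :
    3 * ∑ I ∈ s.powerset, PowerSeries.C (∑ i ∈ I, x i) *
        (∑ K ∈ I.powerset, u K * u (I \ K)) * u (s \ I)
      = 2 * (PowerSeries.C (∑ i ∈ s, x i) *
          ∑ I ∈ s.powerset, (∑ K ∈ I.powerset, u K * u (I \ K)) * u (s \ I)) := by
  set S : Finset ι → PowerSeries A := fun I => PowerSeries.C (∑ i ∈ I, x i) with hS
  have hadd : ∀ I K : Finset ι, K ⊆ I → S I = S K + S (I \ K) := by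
    intro I K h
    simp only [hS, ← map_add]
    rw [add_comm, Finset.sum_sdiff h]
  have t12 : ∑ I ∈ s.powerset, ∑ K ∈ I.powerset, S K * u K * u (I \ K) * u (s \ I)
      = ∑ I ∈ s.powerset, ∑ K ∈ I.powerset, S (I \ K) * u K * u (I \ K) * u (s \ I) := by
    refine Finset.sum_congr rfl fun I _ => ?_
    rw [sum_powerset_sdiff I fun K L => S K * u K * u L * u (s \ I)]
    exact Finset.sum_congr rfl fun K _ => by ring
  have t23 : ∑ I ∈ s.powerset, ∑ K ∈ I.powerset, S (I \ K) * u K * u (I \ K) * u (s \ I)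
      = ∑ I ∈ s.powerset, ∑ K ∈ I.powerset, S (s \ I) * u K * u (I \ K) * u (s \ I) := by
    rw [sum_powerset_powerset s fun K L M => S L * u K * u L * u M,
      sum_powerset_powerset s fun K L M => S M * u K * u L * u M]
    refine Finset.sum_congr rfl fun K _ => ?_
    rw [sum_powerset_sdiff (s \ K) fun L M => S L * u K * u L * u M]
    exact Finset.sum_congr rfl fun L _ => by ring
  have e1 : ∑ I ∈ s.powerset, S I * (∑ K ∈ I.powerset, u K * u (I \ K)) * u (s \ I)
      = ∑ I ∈ s.powerset, ∑ K ∈ I.powerset, S K * u K * u (I \ K) * u (s \ I)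
        + ∑ I ∈ s.powerset, ∑ K ∈ I.powerset, S (I \ K) * u K * u (I \ K) * u (s \ I) := by
    rw [← Finset.sum_add_distrib]
    refine Finset.sum_congr rfl fun I _ => ?_
    rw [← Finset.sum_add_distrib, Finset.mul_sum, Finset.sum_mul]
    refine Finset.sum_congr rfl fun K hK => ?_
    rw [hadd I K (mem_powerset.1 hK)]; ring
  have e2 : S s * ∑ I ∈ s.powerset, (∑ K ∈ I.powerset, u K * u (I \ K)) * u (s \ I)
      = ∑ I ∈ s.powerset, S I * (∑ K ∈ I.powerset, u K * u (I \ K)) * u (s \ I)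
        + ∑ I ∈ s.powerset, ∑ K ∈ I.powerset, S (s \ I) * u K * u (I \ K) * u (s \ I) := by
    rw [← Finset.sum_add_distrib, Finset.mul_sum]
    refine Finset.sum_congr rfl fun I hI => ?_
    rw [hadd s I (mem_powerset.1 hI), add_mul, ← mul_assoc, Finset.sum_mul, Finset.mul_sum]
    congr 1
    rw [Finset.mul_sum]
    exact Finset.sum_congr rfl fun K _ => by ring
  change 3 * ∑ I ∈ s.powerset, S I * (∑ K ∈ I.powerset, u K * u (I \ K)) * u (s \ I)
    = 2 * (S s * ∑ I ∈ s.powerset, (∑ K ∈ I.powerset, u K * u (I \ K)) * u (s \ I))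
  rw [e2, e1, t12, t23]; ring

/-- The quotient by `∑ x_i` of `12 (2 ħ d/dħ + |s| - 2)` applied to `∑ U_I U_J`. -/
def quotSeries (x : ι → A) (s : Finset ι) : PowerSeries A :=
  PowerSeries.X * ∑ I ∈ s.powerset,
      PowerSeries.C ((∑ i ∈ I, x i) ^ 2 - (∑ i ∈ I, x i) * (∑ i ∈ s \ I, x i)
        + (∑ i ∈ s \ I, x i) ^ 2) * (useries x I * useries x (s \ I))
    + 8 * ∑ I ∈ s.powerset,
      (∑ K ∈ I.powerset, useries x K * useries x (I \ K)) * useries x (s \ I)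

lemma C_mul_quotSeries (x : ι → A) (s : Finset ι) :
    12 * (2 * eulerOp (∑ I ∈ s.powerset, useries x I * useries x (s \ I))
        + ((s.card : PowerSeries A) - 2) * ∑ I ∈ s.powerset, useries x I * useries x (s \ I))
      = PowerSeries.C (∑ i ∈ s, x i) * quotSeries x s := by
  set u := useries x with hu
  set S : Finset ι → PowerSeries A := fun I => PowerSeries.C (∑ i ∈ I, x i) with hS
  set V : Finset ι → PowerSeries A := fun I => ∑ K ∈ I.powerset, u K * u (I \ K) with hV
  have hE : ∀ I, 12 * (2 * eulerOp (u I) + ((I.card : PowerSeries A) - 1) * u I)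
      = S I ^ 3 * PowerSeries.X * u I + 6 * S I * V I := by
    intro I
    have := useries_quadEq x I
    rw [QuadEq, map_pow] at this
    exact this
  have hterm : ∀ I ∈ s.powerset, 12 * (2 * eulerOp (u I * u (s \ I))
      + ((s.card : PowerSeries A) - 2) * (u I * u (s \ I)))
      = S s * (PowerSeries.X * (PowerSeries.C ((∑ i ∈ I, x i) ^ 2
          - (∑ i ∈ I, x i) * (∑ i ∈ s \ I, x i)
        + (∑ i ∈ s \ I, x i) ^ 2) * (u I * u (s \ I))))
        + 6 * (S I * V I * u (s \ I)) + 6 * (S (s \ I) * V (s \ I) * u I) := by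
    intro I hI
    rw [mem_powerset] at hI
    have hc : (s.card : PowerSeries A) = I.card + (s \ I).card := by
      rw [← Finset.card_sdiff_add_card_eq_card hI]; push_cast; ring
    have hadd : S s = S I + S (s \ I) := by
      simp only [hS, ← map_add]
      rw [add_comm, Finset.sum_sdiff hI]
    rw [eulerOp_mul, hc, hadd]
    simp only [map_add, map_sub, map_mul, map_pow]
    linear_combination u (s \ I) * hE I + u I * hE (s \ I)
  rw [eulerOp_sum]
  have h3 := three_mul_sum_sum_eq x u s
  have hsym : ∑ I ∈ s.powerset, S (s \ I) * V (s \ I) * u I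
      = ∑ I ∈ s.powerset, S I * V I * u (s \ I) :=
    (sum_powerset_sdiff s fun I J => S I * V I * u J).symm
  rw [Finset.mul_sum, Finset.mul_sum, ← Finset.sum_add_distrib, Finset.mul_sum,
    Finset.sum_congr rfl hterm, Finset.sum_add_distrib, Finset.sum_add_distrib,
    ← Finset.mul_sum, ← Finset.mul_sum, ← Finset.mul_sum, ← Finset.mul_sum, hsym, quotSeries]
  change 3 * ∑ I ∈ s.powerset, S I * V I * u (s \ I)
    = 2 * (S s * ∑ I ∈ s.powerset, V I * u (s \ I)) at h3
  change _ = S s * (_ + 8 * ∑ I ∈ s.powerset, V I * u (s \ I))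
  linear_combination 4 * h3

/-- The stable `n`-point function `F_g(x_s)`, given by a polynomial in the `x_i`. -/
def stableF (x : ι → A) (s : Finset ι) (g : ℕ) : A :=
  algebraMap ℚ A (1 / (2 * g + s.card - 1)) *
    (algebraMap ℚ A (1 / 12) * ((∑ i ∈ s, x i) *
      PowerSeries.coeff g (PowerSeries.X * useries x s))
      + algebraMap ℚ A (1 / (24 * (2 * g + s.card - 2))) * PowerSeries.coeff g (quotSeries x s))

lemma sq_mul_stableF (x : ι → A) {s : Finset ι} {g : ℕ} (hg : 2 < 2 * g + s.card) :
    (∑ i ∈ s, x i) ^ 2 * stableF x s g = PowerSeries.coeff g (useries x s) := by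
  have h1 := congrArg (PowerSeries.coeff g) (useries_quadEq x s)
  have h2 := congrArg (PowerSeries.coeff g) (C_mul_quotSeries x s)
  set V := ∑ I ∈ s.powerset, useries x I * useries x (s \ I)
  have h12 : (12 : PowerSeries A) = ((12 : ℕ) : PowerSeries A) := by norm_num
  have h2' : (2 : PowerSeries A) = ((2 : ℕ) : PowerSeries A) := by norm_num
  have h6 : (6 : PowerSeries A) = ((6 : ℕ) : PowerSeries A) := by norm_num
  rw [h12, h2', h6, sub_mul, one_mul, mul_assoc, mul_assoc] at h1
  rw [h12, h2', sub_mul] at h2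
  simp only [map_add, map_sub, coeff_natCast_mul, coeff_eulerOp, PowerSeries.coeff_C_mul] at h1 h2
  have hr : (0 : ℚ) < 2 * g + s.card - 2 := by
    have : (2 : ℚ) < 2 * g + s.card := by exact_mod_cast hg
    linarith
  have e1 : (2 * (g : A) + s.card - 1) * algebraMap ℚ A (1 / (2 * g + s.card - 1)) = 1 := by
    rw [show (2 * (g : A) + s.card - 1) = algebraMap ℚ A (2 * g + s.card - 1) by
      simp [map_ofNat], ← map_mul, mul_one_div_cancel (by linarith), map_one]
  have e2 : (2 * (g : A) + s.card - 2) * algebraMap ℚ A (1 / (24 * (2 * g + s.card - 2)))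
      = algebraMap ℚ A (1 / 24) := by
    rw [show (2 * (g : A) + s.card - 2) = algebraMap ℚ A (2 * g + s.card - 2) by
      simp [map_ofNat], ← map_mul]
    congr 1; field_simp
  have e3 : 12 * algebraMap ℚ A (1 / 12) = 1 := by
    rw [← map_ofNat (algebraMap ℚ A) 12, ← map_mul]; norm_num
  have e4 : 24 * algebraMap ℚ A (1 / 24) = 1 := by
    rw [← map_ofNat (algebraMap ℚ A) 24, ← map_mul]; norm_num
  push_cast at h1 h2
  rw [stableF]
  set S := ∑ i ∈ s, x i
  set q := PowerSeries.coeff g (quotSeries x s)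
  set p := PowerSeries.coeff g (PowerSeries.X * useries x s)
  set v := PowerSeries.coeff g V
  set w := PowerSeries.coeff g (useries x s)
  set a := algebraMap ℚ A (1 / (2 * g + s.card - 1))
  set b := algebraMap ℚ A (1 / (24 * (2 * g + s.card - 2)))
  set c := algebraMap ℚ A (1 / 12)
  set d := algebraMap ℚ A (1 / 24)
  have hv : S * b * q = 12 * d * v := by
    linear_combination (-b) * h2 + 12 * v * e2
  have hc : c = 2 * d := by linear_combination 2 * d * e3 - c * e4
  linear_combination S * a * hv - a * c * h1 + w * e1 - 6 * a * S * v * hc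
    + (a * (2 * (g : A) + s.card - 1) * w) * e3

end Division

section Naturality

variable {A : Type*} [CommRing A] [Algebra ℚ A] {ι : Type*} [DecidableEq ι]

lemma map_quotSeries {B : Type*} [CommRing B] [Algebra ℚ B] (φ : A →+* B) (x : ι → A)
    (s : Finset ι) : PowerSeries.map φ (quotSeries x s) = quotSeries (fun i => φ (x i)) s := by
  simp only [quotSeries, map_add, map_mul, map_sum, map_useries, PowerSeries.map_X,
    PowerSeries.map_C, map_sub, map_pow, map_ofNat]

lemma map_stableF {B : Type*} [CommRing B] [Algebra ℚ B] (φ : A →+* B) (x : ι → A)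
    (s : Finset ι) (g : ℕ) : φ (stableF x s g) = stableF (fun i => φ (x i)) s g := by
  have h : ∀ q : ℚ, φ (algebraMap ℚ A q) = algebraMap ℚ B q := fun q =>
    RingHom.congr_fun (RingHom.ext_rat (φ.comp (algebraMap ℚ A)) (algebraMap ℚ B)) q
  simp only [stableF, map_add, map_mul, map_sum, h, ← PowerSeries.coeff_map,
    map_quotSeries, map_useries, PowerSeries.map_X]

lemma quotSeries_comp {κ : Type*} [DecidableEq κ] (e : ι ↪ κ) (x : κ → A) (s : Finset ι) :
    quotSeries (fun i => x (e i)) s = quotSeries x (s.map e) := by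
  simp only [quotSeries, sum_powerset_map, useries_comp, ← Finset.map_sdiff, Finset.sum_map]

lemma stableF_comp {κ : Type*} [DecidableEq κ] (e : ι ↪ κ) (x : κ → A) (s : Finset ι) (g : ℕ) :
    stableF (fun i => x (e i)) s g = stableF x (s.map e) g := by
  simp only [stableF, quotSeries_comp, useries_comp, Finset.sum_map, Finset.card_map]

end Naturality

section Weights

variable {A : Type*} [CommRing A] [Algebra ℚ A] {ι : Type*} [DecidableEq ι]

/-- A family of subspaces indexed by `ℤ` that is compatible with multiplication. -/
structure IsMulFamily (P : ℤ → Submodule ℚ A) : Prop where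
  one_mem : 1 ∈ P 0
  mul_mem : ∀ {a b : ℤ} {f h : A}, f ∈ P a → h ∈ P b → f * h ∈ P (a + b)

/-- The coefficient of `ħ^g` has weight `3g + c`. -/
def SeriesMem (P : ℤ → Submodule ℚ A) (f : PowerSeries A) (c : ℤ) : Prop :=
  ∀ g : ℕ, PowerSeries.coeff g f ∈ P (3 * g + c)

variable {P : ℤ → Submodule ℚ A}

lemma SeriesMem.add {f h : PowerSeries A} {c : ℤ} (hf : SeriesMem P f c)
    (hh : SeriesMem P h c) : SeriesMem P (f + h) c := fun g => by
  rw [map_add]; exact add_mem (hf g) (hh g)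

lemma SeriesMem.sum {κ : Type*} {t : Finset κ} {f : κ → PowerSeries A} {c : ℤ}
    (hf : ∀ i ∈ t, SeriesMem P (f i) c) : SeriesMem P (∑ i ∈ t, f i) c := fun g => by
  rw [map_sum]; exact sum_mem fun i hi => hf i hi g

lemma SeriesMem.mul (hP : IsMulFamily P) {f h : PowerSeries A} {c d : ℤ}
    (hf : SeriesMem P f c) (hh : SeriesMem P h d) : SeriesMem P (f * h) (c + d) := fun g => by
  rw [PowerSeries.coeff_mul]
  refine sum_mem fun p hp => ?_
  have := hP.mul_mem (hf p.1) (hh p.2)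
  rw [HasAntidiagonal.mem_antidiagonal] at hp
  convert this using 2
  rw [← hp]; push_cast; ring

lemma SeriesMem.C_mul (hP : IsMulFamily P) {a : A} {k : ℤ} (ha : a ∈ P k) {f : PowerSeries A}
    {c : ℤ} (hf : SeriesMem P f c) : SeriesMem P (PowerSeries.C a * f) (k + c) := fun g => by
  rw [PowerSeries.coeff_C_mul]
  convert hP.mul_mem ha (hf g) using 2
  ring

lemma SeriesMem.X_mul {f : PowerSeries A} {c : ℤ} (hf : SeriesMem P f c) :
    SeriesMem P (PowerSeries.X * f) (c - 3) := fun g => by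
  cases g with
  | zero => simp
  | succ g =>
    rw [PowerSeries.coeff_succ_X_mul]
    convert hf g using 2
    push_cast; ring

lemma IsMulFamily.pow_mem (hP : IsMulFamily P) {a : A} (ha : a ∈ P 1) (k : ℕ) :
    a ^ k ∈ P k := by
  induction k with
  | zero => simpa using hP.one_mem
  | succ k ih => rw [pow_succ]; exact_mod_cast hP.mul_mem ih ha

lemma algebraMap_mul_mem {a : A} {k : ℤ} (q : ℚ) (ha : a ∈ P k) : algebraMap ℚ A q * a ∈ P k := by
  rw [← Algebra.smul_def]; exact Submodule.smul_mem _ _ ha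

lemma mem_of_natCast_mul_mem {p : Submodule ℚ A} {k : ℕ} (hk : k ≠ 0) {a : A}
    (h : (k : A) * a ∈ p) : a ∈ p := by
  have := p.smul_mem (1 / k : ℚ) h
  rw [Algebra.smul_def, ← mul_assoc] at this
  have e : algebraMap ℚ A (1 / k) * k = 1 := by
    rw [← map_natCast (algebraMap ℚ A) k, ← map_mul, one_div_mul_cancel (by exact_mod_cast hk),
      map_one]
  rwa [e, one_mul] at this

lemma seriesMem_useries (hP : IsMulFamily P) {x : ι → A} (hx : ∀ i, x i ∈ P 1) (s : Finset ι) :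
    SeriesMem P (useries x s) (s.card - 1) := by
  induction s using Finset.strongInduction with
  | H s ih =>
    rcases Finset.eq_empty_or_nonempty s with rfl | hs
    · intro g; simp
    have hS : (∑ i ∈ s, x i) ∈ P 1 := sum_mem fun i _ => hx i
    have hV : SeriesMem P (∑ I ∈ s.powerset, useries x I * useries x (s \ I)) (s.card - 2) := by
      refine SeriesMem.sum fun I hI => ?_
      rw [mem_powerset] at hI
      by_cases hIs : I = s
      · subst hIs; intro g; simp
      rcases Finset.eq_empty_or_nonempty I with rfl | hne
      · intro g; simp
      have := SeriesMem.mul hP (ih I (lt_of_le_of_ne hI hIs)) (ih _ (Finset.sdiff_ssubset hI hne))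
      convert this using 1
      rw [← Finset.card_sdiff_add_card_eq_card hI]; push_cast; ring
    have heq := useries_quadEq x s
    rw [quadEq_iff_coeff] at heq
    have hcard := Finset.card_pos.2 hs
    have h6 : ∀ {a : A} {k : ℤ}, a ∈ P k → 6 * a ∈ P k := fun {a k} h => by
      have := algebraMap_mul_mem 6 h
      rwa [map_ofNat] at this
    intro g
    induction g with
    | zero =>
      by_cases hc : s.card = 1
      · obtain ⟨i, rfl⟩ := Finset.card_eq_one.1 hc
        rw [coeff_zero_useries_singleton]
        simpa using hP.one_mem
      · apply mem_of_natCast_mul_mem (k := 12 * (s.card - 1)) (by omega)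
        have hcast : ((12 * (s.card - 1) : ℕ) : A) = 12 * ((s.card : A) - 1) := by
          rw [Nat.cast_mul, Nat.cast_sub hcard]; norm_num
        have h0 := heq 0
        simp only [if_true, Nat.cast_zero, mul_zero, zero_add] at h0
        rw [hcast, mul_assoc, h0, mul_assoc]
        apply h6
        convert hP.mul_mem hS (hV 0) using 2
        push_cast; ring
    | succ g ihg =>
      apply mem_of_natCast_mul_mem (k := 12 * (2 * (g + 1) + (s.card - 1))) (by omega)
      have hcast : ((12 * (2 * (g + 1) + (s.card - 1)) : ℕ) : A)
          = 12 * (2 * ((g + 1 : ℕ) : A) + ((s.card : A) - 1)) := by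
        push_cast [Nat.cast_sub hcard]; norm_num
      have h0 := heq (g + 1)
      simp only [Nat.succ_ne_zero, if_false, Nat.add_sub_cancel] at h0
      rw [hcast, mul_assoc, h0, mul_assoc]
      apply add_mem
      · convert hP.mul_mem (hP.pow_mem hS 3) ihg using 2
        push_cast; ring
      · apply h6
        convert hP.mul_mem hS (hV (g + 1)) using 2
        push_cast; ring

lemma stableF_mem (hP : IsMulFamily P) {x : ι → A} (hx : ∀ i, x i ∈ P 1) (s : Finset ι) (g : ℕ) :
    stableF x s g ∈ P (3 * g + s.card - 3) := by
  have hS : ∀ I : Finset ι, (∑ i ∈ I, x i) ∈ P 1 := fun I => sum_mem fun i _ => hx i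
  have hU := seriesMem_useries hP hx
  have hq : SeriesMem P (quotSeries x s) (s.card - 3) := by
    have hc : ∀ {I J : Finset ι}, I ⊆ J → (J.card : ℤ) = I.card + (J \ I).card := by
      intro I J h
      rw [← Finset.card_sdiff_add_card_eq_card h]; push_cast; ring
    refine SeriesMem.add ?_ ?_
    · have : SeriesMem P (∑ I ∈ s.powerset,
          PowerSeries.C ((∑ i ∈ I, x i) ^ 2 - (∑ i ∈ I, x i) * (∑ i ∈ s \ I, x i)
            + (∑ i ∈ s \ I, x i) ^ 2) * (useries x I * useries x (s \ I))) s.card := by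
        refine SeriesMem.sum fun I hI => ?_
        convert SeriesMem.C_mul hP (k := 2) (add_mem (sub_mem (hP.pow_mem (hS I) 2)
          (hP.mul_mem (hS I) (hS (s \ I)))) (hP.pow_mem (hS (s \ I)) 2))
          (SeriesMem.mul hP (hU I) (hU (s \ I))) using 1
        rw [hc (mem_powerset.1 hI)]; ring
      exact this.X_mul
    · intro g
      rw [show (8 : PowerSeries A) = ((8 : ℕ) : PowerSeries A) by norm_num, coeff_natCast_mul]
      have : SeriesMem P (∑ I ∈ s.powerset, (∑ K ∈ I.powerset, useries x K * useries x (I \ K))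
          * useries x (s \ I)) (s.card - 3) := by
        refine SeriesMem.sum fun I hI => ?_
        have h1 : SeriesMem P (∑ K ∈ I.powerset, useries x K * useries x (I \ K))
            (I.card - 2) := by
          refine SeriesMem.sum fun K hK => ?_
          convert SeriesMem.mul hP (hU K) (hU (I \ K)) using 1
          rw [hc (mem_powerset.1 hK)]; ring
        convert SeriesMem.mul hP h1 (hU (s \ I)) using 1
        rw [hc (mem_powerset.1 hI)]; ring
      have := algebraMap_mul_mem 8 (this g)
      rw [map_ofNat] at this
      exact_mod_cast this
  refine algebraMap_mul_mem _ (add_mem (algebraMap_mul_mem _ ?_) (algebraMap_mul_mem _ ?_))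
  · convert hP.mul_mem (hS s) ((hU s).X_mul g) using 2
    ring
  · convert hq g using 2
    ring

end Weights

section Vanishing

variable {A : Type*} [CommRing A] [Algebra ℚ A] {ι : Type*} [DecidableEq ι]

/-- The differential equation satisfied by the series of `U(y, x_I)`. -/
def PointedEq (x : ι → A) (y : A) (w : Finset ι → PowerSeries A) : Prop :=
  ∀ I, 12 * (2 * eulerOp (w I) + (I.card : PowerSeries A) * w I)
    = PowerSeries.C ((y + ∑ i ∈ I, x i) ^ 3) * PowerSeries.X * w I
      + 12 * PowerSeries.C (y + ∑ i ∈ I, x i) * ∑ K ∈ I.powerset, useries x K * w (I \ K)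

/-- A decreasing filtration by ideals. -/
structure IsIdealFiltration (J : ℤ → Ideal A) : Prop where
  anti : Antitone J
  zero : J 0 = ⊤
  mul_mem : ∀ {a b : ℤ} {f h : A}, f ∈ J a → h ∈ J b → f * h ∈ J (a + b)

lemma IsIdealFiltration.isMulFamily {J : ℤ → Ideal A} (hJ : IsIdealFiltration J) :
    IsMulFamily fun k => (J k).restrictScalars ℚ where
  one_mem := by simp [hJ.zero]
  mul_mem := fun h1 h2 => hJ.mul_mem h1 h2

/-- `∑ φ(S_I) w_I w'_{s \ I}`. -/
def pairSum (x : ι → A) (w w' : Finset ι → PowerSeries A) (s : Finset ι)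
    (φ : Polynomial A) : PowerSeries A :=
  ∑ I ∈ s.powerset, PowerSeries.C (φ.eval (∑ i ∈ I, x i)) * (w I * w' (s \ I))

lemma pairSum_eq {x : ι → A} {y : A} {w w' : Finset ι → PowerSeries A}
    (hw : PointedEq x y w) (hw' : PointedEq x (-y) w') (s : Finset ι) (φ : Polynomial A) :
    ∃ (φ' : Polynomial A) (ψ : Finset ι → Polynomial A),
      12 * (2 * eulerOp (pairSum x w w' s φ) + (s.card : PowerSeries A) * pairSum x w w' s φ)
      = PowerSeries.C (∑ i ∈ s, x i) * (PowerSeries.X * pairSum x w w' s φ')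
        + 12 * ∑ K ∈ s.powerset, useries x K *
          (PowerSeries.C (∑ i ∈ s, x i + ∑ i ∈ K, x i) * pairSum x w w' (s \ K) φ
            + PowerSeries.C (∑ i ∈ K, x i) * pairSum x w w' (s \ K) (ψ K)) := by
  set σ : Finset ι → A := fun I => ∑ i ∈ I, x i with hσ
  have hadd : ∀ {I K : Finset ι}, K ⊆ I → σ I = σ K + σ (I \ K) := by
    intro I K h
    simp only [hσ]
    rw [add_comm, Finset.sum_sdiff h]
  have hdvd : ∀ c : A, ∃ ψ : Polynomial A, ∀ a, φ.eval (a + c) = φ.eval a + c * ψ.eval a := by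
    intro c
    induction φ using Polynomial.induction_on' with
    | add p q hp hq =>
      obtain ⟨ψ, hψ⟩ := hp
      obtain ⟨χ, hχ⟩ := hq
      exact ⟨ψ + χ, fun a => by simp only [Polynomial.eval_add, hψ, hχ]; ring⟩
    | monomial k b =>
      refine ⟨Polynomial.C b * ∑ i ∈ range k,
        (Polynomial.X + Polynomial.C c) ^ i * Polynomial.X ^ (k - 1 - i), fun a => ?_⟩
      have := (Commute.all (a + c) a).geom_sum₂_mul k
      simp only [Polynomial.eval_monomial, Polynomial.eval_mul, Polynomial.eval_C,
        Polynomial.eval_finsetSum, Polynomial.eval_pow, Polynomial.eval_add, Polynomial.eval_X]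
      linear_combination (-b) * this
  choose δ hδ using hdvd
  refine ⟨φ * ((Polynomial.C y + Polynomial.X) ^ 2
      - (Polynomial.C y + Polynomial.X) * (Polynomial.C (σ s - y) - Polynomial.X)
      + (Polynomial.C (σ s - y) - Polynomial.X) ^ 2),
    fun K => δ (σ K) * (Polynomial.C (y + σ K) + Polynomial.X), ?_⟩
  have hterm : ∀ I ∈ s.powerset,
      12 * (2 * eulerOp (PowerSeries.C (φ.eval (σ I)) * (w I * w' (s \ I)))
        + (s.card : PowerSeries A) * (PowerSeries.C (φ.eval (σ I)) * (w I * w' (s \ I))))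
      = PowerSeries.C (σ s) * (PowerSeries.X * (PowerSeries.C (Polynomial.eval (σ I)
          (φ * ((Polynomial.C y + Polynomial.X) ^ 2
      - (Polynomial.C y + Polynomial.X) * (Polynomial.C (σ s - y) - Polynomial.X)
      + (Polynomial.C (σ s - y) - Polynomial.X) ^ 2))) * (w I * w' (s \ I))))
        + 12 * (∑ K ∈ I.powerset, PowerSeries.C (φ.eval (σ I) * (y + σ I)) *
            (useries x K * (w (I \ K) * w' (s \ I))))
        + 12 * (∑ K ∈ (s \ I).powerset, PowerSeries.C (φ.eval (σ I) * (-y + σ (s \ I))) *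
            (useries x K * (w I * w' ((s \ I) \ K)))) := by
    intro I hI
    rw [mem_powerset] at hI
    have hc : (s.card : PowerSeries A) = I.card + (s \ I).card := by
      rw [← Finset.card_sdiff_add_card_eq_card hI]; push_cast; ring
    have h1 := hw I
    have h2 := hw' (s \ I)
    have e1 : ∑ K ∈ I.powerset, PowerSeries.C (φ.eval (σ I) * (y + σ I)) *
            (useries x K * (w (I \ K) * w' (s \ I)))
        = PowerSeries.C (φ.eval (σ I) * (y + σ I)) *
            ((∑ K ∈ I.powerset, useries x K * w (I \ K)) * w' (s \ I)) := by
      rw [Finset.sum_mul, Finset.mul_sum]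
      exact Finset.sum_congr rfl fun K _ => by ring
    have e2 : ∑ K ∈ (s \ I).powerset, PowerSeries.C (φ.eval (σ I) * (-y + σ (s \ I))) *
            (useries x K * (w I * w' ((s \ I) \ K)))
        = PowerSeries.C (φ.eval (σ I) * (-y + σ (s \ I))) *
            ((∑ K ∈ (s \ I).powerset, useries x K * w' ((s \ I) \ K)) * w I) := by
      rw [Finset.sum_mul, Finset.mul_sum]
      exact Finset.sum_congr rfl fun K _ => by ring
    rw [e1, e2, eulerOp_C_mul, eulerOp_mul, hc, hadd hI]
    simp only [Polynomial.eval_mul, Polynomial.eval_add, Polynomial.eval_sub, Polynomial.eval_pow,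
      Polynomial.eval_C, Polynomial.eval_X, map_mul, map_add, map_sub, map_pow, map_neg] at h1 h2 ⊢
    linear_combination PowerSeries.C (φ.eval (σ I)) * (w' (s \ I) * h1 + w I * h2)
  have hK1 : ∑ I ∈ s.powerset, ∑ K ∈ I.powerset, PowerSeries.C (φ.eval (σ I) * (y + σ I)) *
            (useries x K * (w (I \ K) * w' (s \ I)))
      = ∑ K ∈ s.powerset, ∑ I ∈ (s \ K).powerset,
          PowerSeries.C (φ.eval (σ I + σ K) * (y + (σ I + σ K))) *
            (useries x K * (w I * w' ((s \ K) \ I))) := by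
    rw [← sum_powerset_powerset s fun K I J =>
      PowerSeries.C (φ.eval (σ I + σ K) * (y + (σ I + σ K))) * (useries x K * (w I * w' J))]
    refine Finset.sum_congr rfl fun I _ => Finset.sum_congr rfl fun K hK => ?_
    rw [hadd (mem_powerset.1 hK), add_comm (σ K)]
  have hK2 : ∑ I ∈ s.powerset, ∑ K ∈ (s \ I).powerset,
        PowerSeries.C (φ.eval (σ I) * (-y + σ (s \ I))) * (useries x K * (w I * w' ((s \ I) \ K)))
      = ∑ K ∈ s.powerset, ∑ I ∈ (s \ K).powerset,
          PowerSeries.C (φ.eval (σ I) * (-y + (σ K + σ ((s \ K) \ I)))) *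
            (useries x K * (w I * w' ((s \ K) \ I))) := by
    have : ∀ I ∈ s.powerset, ∑ K ∈ (s \ I).powerset,
        PowerSeries.C (φ.eval (σ I) * (-y + σ (s \ I))) * (useries x K * (w I * w' ((s \ I) \ K)))
        = ∑ K ∈ (s \ I).powerset, PowerSeries.C (φ.eval (σ I) * (-y + (σ K + σ ((s \ I) \ K)))) *
            (useries x K * (w I * w' ((s \ I) \ K))) :=
      fun I _ => Finset.sum_congr rfl fun K hK => by rw [hadd (mem_powerset.1 hK)]
    rw [Finset.sum_congr rfl this,
      ← sum_powerset_powerset s fun I K J => PowerSeries.C (φ.eval (σ I) * (-y + (σ K + σ J))) *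
            (useries x K * (w I * w' J)),
      ← sum_powerset_powerset s fun K I J => PowerSeries.C (φ.eval (σ I) * (-y + (σ K + σ J))) *
            (useries x K * (w I * w' J))]
    exact Finset.sum_congr rfl fun I _ => sum_powerset_sdiff I fun K L =>
      PowerSeries.C (φ.eval (σ K) * (-y + (σ L + σ (s \ I)))) *
            (useries x L * (w K * w' (s \ I)))
  have hcomb : ∀ K ∈ s.powerset, ∑ I ∈ (s \ K).powerset,
          PowerSeries.C (φ.eval (σ I + σ K) * (y + (σ I + σ K))) *
            (useries x K * (w I * w' ((s \ K) \ I)))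
      + ∑ I ∈ (s \ K).powerset,
          PowerSeries.C (φ.eval (σ I) * (-y + (σ K + σ ((s \ K) \ I)))) *
            (useries x K * (w I * w' ((s \ K) \ I)))
      = useries x K *
          (PowerSeries.C (σ s + σ K) * pairSum x w w' (s \ K) φ
            + PowerSeries.C (σ K) * pairSum x w w' (s \ K)
                (δ (σ K) * (Polynomial.C (y + σ K) + Polynomial.X))) := by
    intro K hK
    rw [pairSum, pairSum, Finset.mul_sum, Finset.mul_sum, ← Finset.sum_add_distrib,
      ← Finset.sum_add_distrib, Finset.mul_sum]
    refine Finset.sum_congr rfl fun I hI => ?_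
    rw [hδ, hadd (mem_powerset.1 hK), hadd (mem_powerset.1 hI)]
    change _ = useries x K * (_ * (PowerSeries.C (φ.eval (σ I)) * _)
      + _ * (PowerSeries.C (Polynomial.eval (σ I) _) * _))
    simp only [Polynomial.eval_mul, Polynomial.eval_add, Polynomial.eval_C, Polynomial.eval_X,
      map_mul, map_add, map_neg]
    ring
  change 12 * (2 * eulerOp (∑ I ∈ s.powerset, PowerSeries.C (φ.eval (σ I)) * (w I * w' (s \ I)))
      + (s.card : PowerSeries A) * ∑ I ∈ s.powerset,
        PowerSeries.C (φ.eval (σ I)) * (w I * w' (s \ I))) = _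
  rw [eulerOp_sum, Finset.mul_sum, Finset.mul_sum, ← Finset.sum_add_distrib, Finset.mul_sum,
    Finset.sum_congr rfl hterm, Finset.sum_add_distrib, Finset.sum_add_distrib,
    ← Finset.mul_sum, ← Finset.mul_sum, ← Finset.mul_sum, ← Finset.mul_sum, hK1, hK2, add_assoc,
    ← mul_add, ← Finset.sum_add_distrib, Finset.sum_congr rfl hcomb]
  rfl

/-- The coefficient of `ħ^g` of `∑ φ(S_I) w_I w'_{s \ I}` lies in the `(g + |s|)`-th step of the
filtration: the terms of large degree in `y` cancel. -/
lemma coeff_pairSum_mem {J : ℤ → Ideal A} (hJ : IsIdealFiltration J) {x : ι → A}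
    (hx : ∀ i, x i ∈ J 1) {y : A} {w w' : Finset ι → PowerSeries A}
    (hw : PointedEq x y w) (hw' : PointedEq x (-y) w') (s : Finset ι) :
    ∀ (φ : Polynomial A) (g : ℕ), PowerSeries.coeff g (pairSum x w w' s φ) ∈ J (g + s.card) := by
  induction s using Finset.strongInduction with
  | H s ih =>
    intro φ g
    induction g using Nat.strong_induction_on generalizing φ with
    | _ g ihg =>
      by_cases h0 : 2 * g + s.card = 0
      · have : (g : ℤ) + s.card = 0 := by omega
        rw [this, hJ.zero]; trivial
      obtain ⟨φ', ψ, h⟩ := pairSum_eq hw hw' s φ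
      have hS : ∀ I : Finset ι, (∑ i ∈ I, x i) ∈ J 1 := fun I => sum_mem fun i _ => hx i
      have hg := congrArg (PowerSeries.coeff g) h
      have h12 : (12 : PowerSeries A) = ((12 : ℕ) : PowerSeries A) := by norm_num
      have h2 : (2 : PowerSeries A) = ((2 : ℕ) : PowerSeries A) := by norm_num
      rw [h12, h2] at hg
      simp only [map_add, coeff_natCast_mul, coeff_eulerOp] at hg
      change _ ∈ (J (g + s.card)).restrictScalars ℚ
      apply mem_of_natCast_mul_mem (k := 12 * (2 * g + s.card)) (by omega)
      have hcast : ((12 * (2 * g + s.card) : ℕ) : A) * PowerSeries.coeff g (pairSum x w w' s φ)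
          = (12 : ℕ) * ((2 : ℕ) * (g * PowerSeries.coeff g (pairSum x w w' s φ))
            + s.card * PowerSeries.coeff g (pairSum x w w' s φ)) := by
        push_cast; ring
      rw [hcast, hg, Submodule.restrictScalars_mem]
      refine add_mem ?_ (Ideal.mul_mem_left _ _ ?_)
      · rw [PowerSeries.coeff_C_mul]
        cases g with
        | zero => simp
        | succ g =>
          rw [PowerSeries.coeff_succ_X_mul]
          convert hJ.mul_mem (hS s) (ihg g (Nat.lt_succ_self g) φ') using 2
          push_cast; ring
      · rw [map_sum]
        refine sum_mem fun K hK => ?_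
        rw [mem_powerset] at hK
        rcases Finset.eq_empty_or_nonempty K with rfl | hne
        · simp
        rw [PowerSeries.coeff_mul]
        refine sum_mem fun p hp => ?_
        rw [HasAntidiagonal.mem_antidiagonal] at hp
        have hu := seriesMem_useries hJ.isMulFamily hx K p.1
        have hss := Finset.sdiff_ssubset hK hne
        have hcd := Finset.card_sdiff_add_card_eq_card hK
        have hM : ∀ χ, PowerSeries.coeff p.2 (pairSum x w w' (s \ K) χ)
            ∈ J (p.2 + (s \ K).card) := fun χ => ih _ hss χ p.2
        rw [map_add, ← map_add PowerSeries.C, PowerSeries.coeff_C_mul, PowerSeries.coeff_C_mul]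
        have h3 := hJ.mul_mem hu (add_mem (hJ.mul_mem (add_mem (hS s) (hS K)) (hM φ))
          (hJ.mul_mem (hS K) (hM (ψ K))))
        refine hJ.anti ?_ h3
        omega

end Vanishing

section Bridge

lemma Gf_eq_Gnpt (n : ℕ) : ∀ fuel, n ≤ fuel → ∀ g, Gf fuel n g = Gnpt n g := by
  induction n using Nat.strong_induction_on with
  | _ n ih =>
    intro fuel hf g
    rcases n with _ | _ | n
    · simp [Gnpt, Gf]
    · cases g <;> simp [Gnpt, Gf]
    · obtain ⟨m, rfl⟩ : ∃ m, fuel = m + 1 := ⟨fuel - 1, by omega⟩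
      rw [Gnpt, Gf, Gf]
      refine Finset.sum_congr rfl fun s _ => ?_
      congr 3
      refine Finset.sum_congr rfl fun I _ => ?_
      split_ifs with h
      · have h1 : I.card < n + 2 := by
          simpa using Finset.card_lt_card (Finset.ssubset_univ_iff.2 h.2)
        have h2 : Iᶜ.card < n + 2 := by
          have := Finset.card_pos.2 (Finset.nonempty_iff_ne_empty.2 h.1)
          rw [Finset.card_compl, Fintype.card_fin]; omega
        simp only [ih _ h1 m (by omega), ih _ h1 (n + 1) (by omega), ih _ h2 m (by omega),
          ih _ h2 (n + 1) (by omega)]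
      · rfl

lemma Gnpt_add_two (n g : ℕ) : Gnpt (n + 2) g =
    ∑ s ∈ Finset.range (g+1),
      (((Nat.doubleFactorial (2*(g-s)+(n+2)-3) : ℚ) /
          (4^s * (Nat.doubleFactorial (2*g+(n+2)-1) : ℚ))) : K (n+2)) *
        Ppoly (n + 2) (g - s) * (Dlt (n+2))^s := by
  rw [Gnpt, Gf]
  refine Finset.sum_congr rfl fun s _ => ?_
  rw [Ppoly]
  congr 3
  refine Finset.sum_congr rfl fun I _ => ?_
  split_ifs with h
  · have h1 : I.card < n + 2 := by
      simpa using Finset.card_lt_card (Finset.ssubset_univ_iff.2 h.2)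
    have h2 : Iᶜ.card < n + 2 := by
      have := Finset.card_pos.2 (Finset.nonempty_iff_ne_empty.2 h.1)
      rw [Finset.card_compl, Fintype.card_fin]; omega
    simp only [Gf_eq_Gnpt _ (n + 1) (show I.card ≤ n + 1 by omega),
      Gf_eq_Gnpt _ (n + 1) (show Iᶜ.card ≤ n + 1 by omega)]
  · rfl

/-- The recursion for the normalized `n`-point functions, without double factorials. -/
lemma mul_Gnpt_add_two (n g : ℕ) : (2 * g + n + 1 : K (n + 2)) * Gnpt (n + 2) g
    = Ppoly (n + 2) g + Dlt (n + 2) / 4 * (if g = 0 then 0 else Gnpt (n + 2) (g - 1)) := by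
  have hD : ∀ k, ((2 * k + (n + 2) - 1).doubleFactorial : K (n + 2))
      = (2 * k + n + 1) * ((2 * k + (n + 2) - 3).doubleFactorial) := by
    intro k
    by_cases h : 2 * k + n = 0
    · obtain ⟨rfl, rfl⟩ : k = 0 ∧ n = 0 := by omega
      simp [Nat.doubleFactorial]
    · rw [show 2 * k + (n + 2) - 1 = (2 * k + (n + 2) - 3) + 2 by omega,
        Nat.doubleFactorial_add_two, show 2 * k + (n + 2) - 3 + 2 = 2 * k + n + 1 by omega]
      push_cast; ring
  have hne : ∀ m, ((Nat.doubleFactorial m : ℕ) : K (n + 2)) ≠ 0 := fun m => by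
    exact_mod_cast (Nat.doubleFactorial_pos m).ne'
  have hne' : ∀ k : ℕ, (2 * k + n + 1 : K (n + 2)) ≠ 0 := fun k => by
    exact_mod_cast (show 2 * k + n + 1 ≠ 0 by omega)
  rw [Gnpt_add_two, Finset.sum_range_succ', mul_add, add_comm (Ppoly (n + 2) g)]
  congr 1
  · cases g with
    | zero => simp
    | succ g =>
      rw [if_neg (Nat.succ_ne_zero g), Nat.add_sub_cancel, Gnpt_add_two, Finset.mul_sum,
        Finset.mul_sum]
      refine Finset.sum_congr rfl fun s _ => ?_
      have h1 := hne' (g + 1)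
      have h2 := hne (2 * g + (n + 2) - 1)
      rw [Nat.add_sub_add_right]
      simp only [Rat.cast_natCast]
      rw [hD (g + 1), show 2 * (g + 1) + (n + 2) - 3 = 2 * g + (n + 2) - 1 by omega, pow_succ,
        pow_succ]
      field_simp
  · have := hne (2 * g + (n + 2) - 3)
    have := hne' g
    simp only [Rat.cast_natCast, pow_zero, one_mul, mul_one, Nat.sub_zero]
    rw [hD]
    field_simp

/-- `exp (E ħ)`. -/
def expSeries {L : Type*} [Field L] [CharZero L] (E : L) : PowerSeries L :=
  PowerSeries.rescale E (PowerSeries.exp L)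

lemma coeff_expSeries {L : Type*} [Field L] [CharZero L] (E : L) (d : ℕ) :
    PowerSeries.coeff d (expSeries E) = 1 / (d.factorial : L) * E ^ d := by
  simp [expSeries, PowerSeries.coeff_exp, mul_comm]

lemma expSeries_mul {L : Type*} [Field L] [CharZero L] (E E' : L) :
    expSeries E * expSeries E' = expSeries (E + E') :=
  PowerSeries.exp_mul_exp_eq_exp_add E E'

lemma map_expSeries {L M : Type*} [Field L] [CharZero L] [Field M] [CharZero M] (φ : L →+* M)
    (E : L) : PowerSeries.map φ (expSeries E) = expSeries (φ E) := by
  ext d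
  simp only [PowerSeries.coeff_map, coeff_expSeries, map_mul, map_div₀, map_one, map_natCast,
    map_pow]

lemma eulerOp_expSeries {L : Type*} [Field L] [CharZero L] (E : L) :
    eulerOp (expSeries E) = PowerSeries.C E * (PowerSeries.X * expSeries E) := by
  ext d
  rw [coeff_eulerOp, PowerSeries.coeff_C_mul]
  cases d with
  | zero => simp
  | succ d =>
    rw [PowerSeries.coeff_succ_X_mul, coeff_expSeries, coeff_expSeries, Nat.factorial_succ]
    have : (d.factorial : L) ≠ 0 := by exact_mod_cast d.factorial_ne_zero
    have : (d + 1 : L) ≠ 0 := by exact_mod_cast d.succ_ne_zero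
    push_cast
    field_simp
    ring

/-- The generating series `∑_g G_g(x_1,…,x_n) ħ^g`. -/
def Gseries (n : ℕ) : PowerSeries (K n) := PowerSeries.mk (Gnpt n)

/-- The generating series `∑_g F_g(x_1,…,x_n) ħ^g`. -/
def Fseries (n : ℕ) : PowerSeries (K n) := PowerSeries.mk (Fnpt n)

lemma Fseries_eq (n : ℕ) : Fseries n = expSeries (SX3 n / 24) * Gseries n := by
  ext g
  rw [PowerSeries.coeff_mul, Finset.Nat.sum_antidiagonal_eq_sum_range_succ_mk]
  simp [Fseries, Gseries, Fnpt, coeff_expSeries]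

/-- The variables as elements of `ℚ(x_1,…,x_n)`. -/
def varK (n : ℕ) (i : Fin n) : K n := algebraMap (R n) (K n) (X i)

lemma emb_algebraMap {n : ℕ} (I : Finset (Fin n)) (p : R I.card) :
    emb I (algebraMap (R I.card) (K I.card) p) = embRH I p :=
  IsFractionRing.lift_algebraMap _ _

lemma emb_varK {n : ℕ} (I : Finset (Fin n)) (i : Fin I.card) :
    emb I (varK I.card i) = varK n (I.orderEmbOfFin rfl i) := by
  simp [varK, emb_algebraMap, embRH]

lemma SX_eq (n : ℕ) : SX n = ∑ i, varK n i := by simp [SX, varK]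

lemma SX3_eq (n : ℕ) : SX3 n = ∑ i, varK n i ^ 3 := by simp [SX3, varK]

lemma SX_ne_zero {n : ℕ} (hn : n ≠ 0) : SX n ≠ 0 := by
  obtain ⟨m, rfl⟩ := Nat.exists_eq_succ_of_ne_zero hn
  rw [SX, Ne, FaithfulSMul.algebraMap_eq_zero_iff]
  intro h
  have := congrArg (MvPolynomial.eval (fun i : Fin (m + 1) => if i = 0 then (1 : ℚ) else 0)) h
  simp at this

lemma sum_orderEmbOfFin {n : ℕ} {M : Type*} [AddCommMonoid M] (I : Finset (Fin n))
    (f : Fin n → M) : ∑ i, f (I.orderEmbOfFin rfl i) = ∑ i ∈ I, f i := by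
  conv_rhs => rw [← Finset.map_orderEmbOfFin_univ I rfl]
  rw [Finset.sum_map]; rfl

lemma C_mul_expSeries_Ppoly (n : ℕ) (hn : n ≠ 0) :
    PowerSeries.C (2 * SX n) * (expSeries (SX3 n / 24) * PowerSeries.mk (Ppoly n))
      = ∑ I : Finset (Fin n), if I ≠ ∅ ∧ I ≠ univ then
          PowerSeries.map (emb I) (PowerSeries.C (SX I.card ^ 2) * Fseries I.card) *
          PowerSeries.map (emb Iᶜ) (PowerSeries.C (SX Iᶜ.card ^ 2) * Fseries Iᶜ.card) else 0 := by
  have hP : PowerSeries.C (2 * SX n) * PowerSeries.mk (Ppoly n)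
      = ∑ I : Finset (Fin n), if I ≠ ∅ ∧ I ≠ univ then
          PowerSeries.C ((∑ i ∈ I, varK n i) ^ 2 * (∑ i ∈ Iᶜ, varK n i) ^ 2) *
          (PowerSeries.map (emb I) (Gseries I.card) * PowerSeries.map (emb Iᶜ) (Gseries Iᶜ.card))
          else 0 := by
    ext r
    have h2 : 2 * SX n ≠ 0 := mul_ne_zero two_ne_zero (SX_ne_zero hn)
    rw [PowerSeries.coeff_C_mul, PowerSeries.coeff_mk, Ppoly, mul_inv_cancel_left₀ h2, map_sum]
    refine Finset.sum_congr rfl fun I _ => ?_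
    split_ifs
    · rw [PowerSeries.coeff_C_mul, PowerSeries.coeff_mul,
        Finset.Nat.sum_antidiagonal_eq_sum_range_succ_mk]
      simp [Gseries, varK]
    · simp
  rw [mul_left_comm, hP, Finset.mul_sum]
  refine Finset.sum_congr rfl fun I _ => ?_
  split_ifs
  · have hE : expSeries (SX3 n / 24) = PowerSeries.map (emb I) (expSeries (SX3 I.card / 24)) *
        PowerSeries.map (emb Iᶜ) (expSeries (SX3 Iᶜ.card / 24)) := by
      rw [map_expSeries, map_expSeries, expSeries_mul]
      congr 1
      simp only [SX3_eq, map_div₀, map_sum, map_pow, emb_varK, map_ofNat,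
        sum_orderEmbOfFin I (fun i => varK n i ^ 3), sum_orderEmbOfFin Iᶜ (fun i => varK n i ^ 3)]
      rw [← Finset.sum_add_sum_compl I, add_div]
    have hS : ∀ I : Finset (Fin n), emb I (SX I.card) = ∑ i ∈ I, varK n i := fun I => by
      simp only [SX_eq, map_sum, emb_varK, sum_orderEmbOfFin I (fun i => varK n i)]
    rw [hE, Fseries_eq, Fseries_eq]
    simp only [map_mul, PowerSeries.map_C, map_pow, hS]
    ring
  · simp

lemma eulerOp_Fseries (n : ℕ) : 12 * (2 * eulerOp (Fseries (n + 2))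
      + (((n + 2 : ℕ) : PowerSeries (K (n + 2))) - 1) * Fseries (n + 2))
    = PowerSeries.C (SX (n + 2) ^ 3) * PowerSeries.X * Fseries (n + 2)
      + 12 * (expSeries (SX3 (n + 2) / 24) * PowerSeries.mk (Ppoly (n + 2))) := by
  have hG : 2 * eulerOp (Gseries (n + 2)) + ((n : PowerSeries (K (n + 2))) + 1) * Gseries (n + 2)
      = PowerSeries.mk (Ppoly (n + 2))
        + PowerSeries.C (Dlt (n + 2) / 4) * (PowerSeries.X * Gseries (n + 2)) := by
    ext g
    have h2 : (2 : PowerSeries (K (n + 2))) = ((2 : ℕ) : PowerSeries (K (n + 2))) := by norm_num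
    have h3 : (n : PowerSeries (K (n + 2))) + 1 = ((n + 1 : ℕ) : PowerSeries (K (n + 2))) := by
      norm_num
    rw [h2, h3, map_add, coeff_natCast_mul, coeff_natCast_mul, coeff_eulerOp, map_add,
      PowerSeries.coeff_C_mul, PowerSeries.coeff_mk]
    have := mul_Gnpt_add_two n g
    have hX : PowerSeries.coeff g (PowerSeries.X * Gseries (n + 2))
        = if g = 0 then 0 else Gnpt (n + 2) (g - 1) := by
      cases g <;> simp [PowerSeries.coeff_succ_X_mul, Gseries]
    rw [hX, ← this, Gseries, PowerSeries.coeff_mk]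
    push_cast; ring
  have hc : 12 * (2 * PowerSeries.C (SX3 (n + 2) / 24) + PowerSeries.C (Dlt (n + 2) / 4))
      = PowerSeries.C (SX (n + 2) ^ 3) := by
    rw [← map_ofNat (PowerSeries.C (R := K (n + 2))) 12,
      ← map_ofNat (PowerSeries.C (R := K (n + 2))) 2, ← map_mul, ← map_add, ← map_mul, Dlt]
    congr 1; ring
  rw [Fseries_eq, eulerOp_mul, eulerOp_expSeries, ← hc]
  push_cast
  linear_combination 12 * expSeries (SX3 (n + 2) / 24) * hG

/-- The `n`-point functions satisfy the quadratic differential equation that determines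
`useries`. -/
theorem C_mul_Fseries (n : ℕ) (hn : n ≠ 0) :
    PowerSeries.C (SX n ^ 2) * Fseries n = useries (varK n) univ := by
  induction n using Nat.strong_induction_on with
  | _ n ih =>
    set v : Finset (Fin n) → PowerSeries (K n) := fun I =>
      if I = univ then PowerSeries.C (SX n ^ 2) * Fseries n else useries (varK n) I with hv
    have huniv : v univ = PowerSeries.C (SX n ^ 2) * Fseries n := by simp [hv]
    have hne : (univ : Finset (Fin n)).Nonempty := by
      have : NeZero n := ⟨hn⟩
      exact univ_nonempty
    have h0 : v ∅ = 0 := by simp only [hv, if_neg hne.ne_empty.symm, useries_empty]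
    have hlt : ∀ I, I ⊂ univ → v I = useries (varK n) I := fun I hI => by
      simp only [hv, if_neg hI.ne]
    rw [← huniv]
    rcases n with _ | _ | n
    · exact absurd rfl hn
    · have hx := SX_ne_zero one_ne_zero
      have hF : PowerSeries.C (SX 1 ^ 2) * Fseries 1 = expSeries (SX 1 ^ 3 / 24) := by
        have hG : Gseries 1 = PowerSeries.C (SX 1 ^ (-2 : ℤ)) := by
          ext g
          cases g <;> simp [Gseries, Gnpt, Gf, SX, PowerSeries.coeff_C]
        have h3 : SX3 1 = SX 1 ^ 3 := by simp [SX, SX3]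
        rw [Fseries_eq, hG, h3, mul_left_comm, ← map_mul, zpow_neg]
        have : SX 1 ^ 2 * (SX 1 ^ (2 : ℤ))⁻¹ = 1 := mul_inv_cancel₀ (pow_ne_zero 2 hx)
        rw [this, map_one, mul_one]
      refine eq_useries_of_quadEq hne h0 (fun _ => ?_) hlt ?_
      · rw [huniv]
        change PowerSeries.coeff 0 (PowerSeries.C (SX 1 ^ 2) * Fseries 1) = 1
        rw [hF, coeff_expSeries]; simp
      · have hsum : ∑ I ∈ (univ : Finset (Fin 1)).powerset, v I * v (univ \ I) = 0 := by
          refine Finset.sum_eq_zero fun I _ => ?_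
          rcases Finset.eq_empty_or_nonempty I with rfl | hI
          · rw [h0, zero_mul]
          · have : I = univ := by
              obtain ⟨i, hi⟩ := hI
              ext j
              exact iff_of_true (Subsingleton.elim i j ▸ hi) (mem_univ j)
            rw [this, sdiff_self, Finset.bot_eq_empty, h0, mul_zero]
        have h24 : (24 : PowerSeries (K 1)) * PowerSeries.C (SX 1 ^ 3 / 24)
            = PowerSeries.C (SX 1 ^ 3) := by
          rw [← map_ofNat (PowerSeries.C (R := K 1)) 24, ← map_mul]
          congr 1; ring
        have hs : ∑ i, varK 1 i = SX 1 := (SX_eq 1).symm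
        have hv1 : v univ = expSeries (SX 1 ^ 3 / 24) := huniv.trans hF
        rw [QuadEq, hsum, hv1, eulerOp_expSeries]
        change _ = PowerSeries.C ((∑ i, varK 1 i) ^ 3) * _ * _ + _
        rw [hs, ← h24, card_univ, Fintype.card_fin]
        push_cast
        ring
    · refine eq_useries_of_quadEq hne h0 (fun h => ?_) hlt ?_
      · simp at h
      · have hIH : ∀ I : Finset (Fin (n + 2)), I ≠ ∅ → I ≠ univ →
            PowerSeries.map (emb I) (PowerSeries.C (SX I.card ^ 2) * Fseries I.card) = v I := by
          intro I h1 h2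
          have hI : I.card < n + 2 := by
            simpa using Finset.card_lt_card (Finset.ssubset_univ_iff.2 h2)
          rw [ih _ hI (Finset.card_ne_zero.2 (Finset.nonempty_iff_ne_empty.2 h1)), map_useries,
            hlt I (Finset.ssubset_univ_iff.2 h2)]
          simp only [emb_varK]
          have := useries_comp (I.orderEmbOfFin rfl).toEmbedding (varK (n + 2)) univ
          rw [Finset.map_orderEmbOfFin_univ] at this
          exact this
        have hsum : ∑ I ∈ (univ : Finset (Fin (n + 2))).powerset, v I * v (univ \ I)
            = ∑ I : Finset (Fin (n + 2)), if I ≠ ∅ ∧ I ≠ univ then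
          PowerSeries.map (emb I) (PowerSeries.C (SX I.card ^ 2) * Fseries I.card) *
          PowerSeries.map (emb Iᶜ) (PowerSeries.C (SX Iᶜ.card ^ 2) * Fseries Iᶜ.card) else 0 := by
          rw [powerset_univ]
          refine Finset.sum_congr rfl fun I _ => ?_
          rw [← Finset.compl_eq_univ_sdiff]
          split_ifs with h
          · rw [hIH I h.1 h.2, hIH Iᶜ (by simpa using h.2) (by simpa using h.1)]
          · by_cases h1 : I = ∅
            · rw [h1, h0, zero_mul]
            · have : I = univ := by tauto
              rw [this, compl_univ, h0, mul_zero]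
        rw [QuadEq, hsum, ← C_mul_expSeries_Ppoly _ hn, huniv, eulerOp_C_mul, ← SX_eq, card_univ,
          Fintype.card_fin]
        have h6 : (6 : PowerSeries (K (n + 2))) * PowerSeries.C 2 = 12 := by
          rw [map_ofNat]; norm_num
        simp only [map_mul, map_pow]
        have := eulerOp_Fseries n
        simp only [map_pow] at this
        linear_combination PowerSeries.C (SX (n + 2)) ^ 2 * this - PowerSeries.C (SX (n + 2)) ^ 2 *
          (expSeries (SX3 (n + 2) / 24) * PowerSeries.mk (Ppoly (n + 2))) * h6

end Bridge

section Brackets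

/-- The polynomial `F_g(x_1,…,x_n)` for `2g - 2 + n > 0`. -/
def npointPoly (n g : ℕ) : R n := stableF (fun i : Fin n => (X i : R n)) univ g

lemma Fnpt_eq_algebraMap {n g : ℕ} (hn : n ≠ 0) (h : 2 < 2 * g + n) :
    Fnpt n g = algebraMap (R n) (K n) (npointPoly n g) := by
  have h1 := congrArg (PowerSeries.coeff g) (C_mul_Fseries n hn)
  have h2 : useries (varK n) univ
      = PowerSeries.map (algebraMap (R n) (K n)) (useries (fun i : Fin n => (X i : R n)) univ) :=
    (map_useries _ _ _).symm
  rw [h2, PowerSeries.coeff_map, PowerSeries.coeff_C_mul,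
    ← sq_mul_stableF _ (show 2 < 2 * g + (univ : Finset (Fin n)).card by simpa using h), map_mul,
    map_pow] at h1
  exact mul_left_cancel₀ (pow_ne_zero 2 (SX_ne_zero hn)) ((congrArg (SX n ^ 2 * ·)
    (PowerSeries.coeff_mk g (Fnpt n))).symm.trans h1)

lemma bracket_eq_coeff {n g : ℕ} (hn : n ≠ 0) (h : 2 < 2 * g + n) (d : Fin n → ℕ) :
    bracket g d = coeff (Finsupp.equivFunOnFinite.symm d) (npointPoly n g) := by
  have hex : ∃ p : R n, algebraMap (R n) (K n) p = Fnpt n g := ⟨_, (Fnpt_eq_algebraMap hn h).symm⟩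
  rw [bracket, if_neg (by omega), coeffK, dif_pos hex]
  congr 1
  apply IsFractionRing.injective (R n) (K n)
  rw [hex.choose_spec, Fnpt_eq_algebraMap hn h]

lemma isMulFamily_homogeneousSubmodule (n : ℕ) :
    IsMulFamily fun k : ℤ => if 0 ≤ k then homogeneousSubmodule (Fin n) ℚ k.toNat else ⊥ where
  one_mem := isHomogeneous_one (Fin n) ℚ
  mul_mem := by
    intro a b f h hf hh
    split_ifs at hf with ha
    · split_ifs at hh with hb
      · rw [if_pos (add_nonneg ha hb), Int.toNat_add ha hb]
        exact IsHomogeneous.mul hf hh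
      · rw [(Submodule.mem_bot ℚ).1 hh, mul_zero]; exact zero_mem _
    · rw [(Submodule.mem_bot ℚ).1 hf, zero_mul]; exact zero_mem _

lemma coeff_npointPoly_eq_zero {n g : ℕ} {k : Fin n →₀ ℕ} (h : ∑ i, k i + 3 ≠ 3 * g + n) :
    coeff k (npointPoly n g) = 0 := by
  have hm := stableF_mem (isMulFamily_homogeneousSubmodule n) (x := fun i : Fin n => (X i : R n))
    (fun i => by simpa using isHomogeneous_X ℚ i) univ g
  rw [card_univ, Fintype.card_fin] at hm
  split_ifs at hm with h0
  · refine IsHomogeneous.coeff_eq_zero hm ?_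
    rw [Finsupp.degree_eq_sum]
    omega
  · rw [npointPoly, (Submodule.mem_bot ℚ).1 hm, coeff_zero]

lemma bracket_eq_zero_of_sum_ne {n g : ℕ} (hn : n ≠ 0) {d : Fin n → ℕ}
    (h : ∑ i, d i + 3 ≠ 3 * g + n) : bracket g d = 0 := by
  by_cases h2 : 2 < 2 * g + n
  · rw [bracket_eq_coeff hn h2]
    exact coeff_npointPoly_eq_zero (by simpa using h)
  · rw [bracket, if_pos (by omega)]

lemma bracket_comp_equiv {m n : ℕ} (hn : n ≠ 0) (g : ℕ) (e : Fin m ≃ Fin n) (d : Fin n → ℕ) :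
    bracket g (fun i => d (e i)) = bracket g d := by
  have hmn : m = n := by simpa using Fintype.card_congr e
  by_cases h2 : 2 < 2 * g + n
  · rw [bracket_eq_coeff hn h2, bracket_eq_coeff (hmn ▸ hn) (hmn ▸ h2)]
    have h1 : npointPoly n g = rename e (npointPoly m g) := by
      have := map_stableF (rename e : R m →ₐ[ℚ] R n).toRingHom (fun i : Fin m => (X i : R m)) univ g
      simp only [AlgHom.toRingHom_eq_coe, RingHom.coe_coe, rename_X] at this
      have h3 := stableF_comp e.toEmbedding (fun i : Fin n => (X i : R n)) univ g
      rw [Finset.map_univ_equiv] at h3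
      exact h3.symm.trans this.symm
    have hd : Finsupp.equivFunOnFinite.symm d
        = Finsupp.mapDomain e (Finsupp.equivFunOnFinite.symm fun i => d (e i)) := by
      ext i
      rw [Finsupp.mapDomain_equiv_apply]; simp
    rw [h1, hd, coeff_rename_mapDomain _ e.injective]
  · rw [bracket, bracket, if_pos (by omega), if_pos (by omega)]

lemma cons_orderEmbOfFin_injective {n : ℕ} {κ : Type*} (I : Finset (Fin n)) (a : κ)
    {f : Fin n → κ} (hf : Function.Injective f) (ha : ∀ i ∈ I, f i ≠ a) :
    Function.Injective (Fin.cons a (fun i => f (I.orderEmbOfFin rfl i)) : Fin (I.card + 1) → κ) := by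
  rw [Fin.cons_injective_iff]
  refine ⟨?_, hf.comp (I.orderEmbOfFin rfl).injective⟩
  rintro ⟨i, hi⟩
  exact ha _ (I.orderEmbOfFin_mem rfl i) hi

lemma bracketI_eq_bracket {n m : ℕ} (hm : m ≠ 0) (g j : ℕ) (I : Finset (Fin n)) (d : Fin n → ℕ)
    (hc : I.card + 1 = m) (a : Fin m) {f : Fin n → Fin m} (hf : Function.Injective f)
    (ha : ∀ i ∈ I, f i ≠ a) (d' : Fin m → ℕ) (hda : d' a = j) (hd : ∀ i ∈ I, d' (f i) = d i) :
    bracketI g j I d = bracket g d' := by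
  have hb : Function.Bijective
      (Fin.cons a (fun i => f (I.orderEmbOfFin rfl i)) : Fin (I.card + 1) → Fin m) := by
    rw [Fintype.bijective_iff_injective_and_card]
    exact ⟨cons_orderEmbOfFin_injective I a hf ha, by simpa using hc⟩
  rw [← bracket_comp_equiv hm g (Equiv.ofBijective _ hb) d', bracketI]
  congr 1
  ext i
  refine Fin.cases ?_ (fun i => ?_) i
  · simp [hda]
  · simp [hd _ (I.orderEmbOfFin_mem rfl i)]

lemma bracketI_univ {n : ℕ} (g j : ℕ) (d : Fin n → ℕ) :
    bracketI g j univ d = bracket g (Fin.cons j d : Fin (n + 1) → ℕ) :=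
  bracketI_eq_bracket n.succ_ne_zero g j univ d (by simp) 0 (Fin.succ_injective n)
    (fun i _ => Fin.succ_ne_zero i) _ rfl fun _ _ => rfl

lemma bracketI_compl_singleton {n : ℕ} (g j : ℕ) (i : Fin n) (d : Fin n → ℕ) :
    bracketI g j {i}ᶜ d = bracket g (Function.update d i j) := by
  have hn : n ≠ 0 := fun h => by subst h; exact i.elim0
  refine bracketI_eq_bracket hn g j _ d ?_ i Function.injective_id (fun k hk => by simpa using hk) _
    (Function.update_self i j d) fun k hk => Function.update_of_ne (by simpa using hk) j d
  rw [Finset.card_compl, Fintype.card_fin, Finset.card_singleton]; omega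

lemma bracketI_eq_zero_of_sum_ne {n : ℕ} {g j : ℕ} {I : Finset (Fin n)} {d : Fin n → ℕ}
    (h : j + ∑ i ∈ I, d i + 2 ≠ 3 * g + I.card) : bracketI g j I d = 0 := by
  refine bracket_eq_zero_of_sum_ne (Nat.succ_ne_zero _) ?_
  rw [Fin.sum_univ_succ]
  have := sum_orderEmbOfFin I d
  simp only [Fin.cons_zero, Fin.cons_succ, coe_orderIsoOfFin_apply]
  rw [this]
  omega

end Brackets

section Pointed

variable {A : Type*} [CommRing A] [Algebra ℚ A] {ι : Type*} [DecidableEq ι]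

/-- The variables `x` together with a marked variable `y`. -/
def withMarked (y : A) (x : ι → A) : Option ι → A := fun o => o.elim y x

/-- The series `∑_g (y + ∑_{i ∈ I} x_i)² F_g(y, x_I) ħ^g`. -/
def pointedSeries (x : ι → A) (y : A) (I : Finset ι) : PowerSeries A :=
  useries (withMarked y x) (insertNone I)

omit [Algebra ℚ A] [DecidableEq ι] in
lemma sum_withMarked_insertNone (x : ι → A) (y : A) (I : Finset ι) :
    ∑ o ∈ insertNone I, withMarked y x o = y + ∑ i ∈ I, x i := by
  rw [Finset.sum_insertNone]; rfl

lemma insertNone_eq_insert (I : Finset ι) :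
    insertNone I = insert none (I.map Function.Embedding.some) := by
  ext o; cases o <;> simp

lemma sum_powerset_insertNone {M : Type*} [AddCommMonoid M] (I : Finset ι)
    (f : Finset (Option ι) → M) : ∑ L ∈ (insertNone I).powerset, f L
      = ∑ L ∈ I.powerset, f (L.map Function.Embedding.some) + ∑ L ∈ I.powerset, f (insertNone L) := by
  rw [insertNone_eq_insert, Finset.sum_powerset_insert (by simp), sum_powerset_map,
    sum_powerset_map]
  simp only [insertNone_eq_insert]

lemma useries_withMarked_map (x : ι → A) (y : A) (I : Finset ι) :
    useries (withMarked y x) (I.map Function.Embedding.some) = useries x I :=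
  (useries_comp Function.Embedding.some (withMarked y x) I).symm

lemma pointedSeries_pointedEq (x : ι → A) (y : A) : PointedEq x y (pointedSeries x y) := by
  intro I
  have h := useries_quadEq (withMarked y x) (insertNone I)
  have h1 : ∀ L : Finset ι, insertNone I \ L.map Function.Embedding.some = insertNone (I \ L) := by
    intro L; ext o; cases o <;> simp
  have h2 : ∀ L : Finset ι, insertNone I \ insertNone L = (I \ L).map Function.Embedding.some := by
    intro L; ext o; cases o <;> simp
  rw [QuadEq, sum_powerset_insertNone, sum_withMarked_insertNone, Finset.card_insertNone] at h
  simp only [h1, h2, useries_withMarked_map] at h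
  rw [← sum_powerset_sdiff I fun L M => useries (withMarked y x) (insertNone M) * useries x L] at h
  simp only [mul_comm (useries (withMarked y x) (insertNone _)) (useries x _)] at h
  simp only [pointedSeries]
  push_cast at h
  linear_combination h

lemma coeff_zero_pointedSeries_empty (x : ι → A) (y : A) :
    PowerSeries.coeff 0 (pointedSeries x y ∅) = 1 := by
  have : insertNone (∅ : Finset ι) = {none} := rfl
  rw [pointedSeries, this, coeff_zero_useries_singleton]

lemma coeff_zero_pointedSeries_singleton (x : ι → A) (y : A) (i : ι) :
    PowerSeries.coeff 0 (pointedSeries x y {i}) = y + x i := by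
  have h := congrArg (PowerSeries.coeff 0) (pointedSeries_pointedEq x y {i})
  have h12 : (12 : PowerSeries A) = ((12 : ℕ) : PowerSeries A) := by norm_num
  have h2 : (2 : PowerSeries A) = ((2 : ℕ) : PowerSeries A) := by norm_num
  rw [h12, h2, mul_assoc, mul_assoc] at h
  have hu : ∑ L ∈ ({i} : Finset ι).powerset, useries x L * pointedSeries x y ({i} \ L)
      = useries x {i} * pointedSeries x y ∅ := by
    rw [show ({i} : Finset ι) = insert i ∅ from rfl, Finset.sum_powerset_insert (by simp)]
    simp
  rw [hu, map_add, coeff_natCast_mul, map_add, coeff_natCast_mul, coeff_natCast_mul, coeff_eulerOp,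
    coeff_natCast_mul, PowerSeries.coeff_C_mul, PowerSeries.coeff_C_mul] at h
  have hm : PowerSeries.coeff 0 (useries x {i} * pointedSeries x y ∅) = 1 := by
    rw [PowerSeries.coeff_mul]
    simp only [Finset.Nat.antidiagonal_zero, Finset.sum_singleton, coeff_zero_useries_singleton,
      coeff_zero_pointedSeries_empty, mul_one]
  rw [hm] at h
  apply (isUnit_natCast_of_ne_zero (A := A) (k := 12) (by norm_num)).mul_left_cancel
  simpa [-PowerSeries.coeff_zero_eq_constantCoeff, PowerSeries.coeff_zero_X_mul] using h

lemma sq_mul_stableF_withMarked (x : ι → A) (y : A) {I : Finset ι} {g : ℕ}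
    (h : 1 < 2 * g + I.card) :
    (y + ∑ i ∈ I, x i) ^ 2 * stableF (withMarked y x) (insertNone I) g
      = PowerSeries.coeff g (pointedSeries x y I) := by
  rw [pointedSeries, ← sq_mul_stableF _ (by rw [Finset.card_insertNone]; omega),
    sum_withMarked_insertNone]

end Pointed

section Truncation

variable {n : ℕ}

/-- The powers of the ideal of polynomials without constant term. -/
def varFiltration (n : ℕ) (k : ℤ) : Ideal (R n) := idealOfVars (Fin n) ℚ ^ k.toNat

lemma isIdealFiltration_varFiltration (n : ℕ) : IsIdealFiltration (varFiltration n) where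
  anti := fun a b h => Ideal.pow_le_pow_right (Int.toNat_le_toNat h)
  zero := by simp [varFiltration]
  mul_mem := by
    intro a b f h hf hh
    have := Ideal.mul_mem_mul hf hh
    rw [varFiltration, varFiltration, ← pow_add] at this
    exact Ideal.pow_le_pow_right (by omega) this

lemma sum_X_mem (I : Finset (Fin n)) : (∑ i ∈ I, X i : R n) ∈ idealOfVars (Fin n) ℚ :=
  sum_mem fun i _ => Ideal.subset_span ⟨i, rfl⟩

/-- A polynomial approximation, modulo polynomials of order at least `N`, to `F_g(c, x_I)`. -/
def approxF (N : ℕ) (c : ℚ) (g : ℕ) (I : Finset (Fin n)) : R n :=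
  if g = 0 ∧ I.card = 0 then 1
  else if g = 0 ∧ I.card = 1 then C c * ∑ k ∈ range N, (C (-c) * ∑ i ∈ I, X i) ^ k
  else stableF (withMarked (C c) fun i => (X i : R n)) (insertNone I) g

lemma sq_mul_approxF_sub_mem (N : ℕ) {c : ℚ} (hc : c ^ 2 = 1) (g : ℕ) (I : Finset (Fin n)) :
    (C c + ∑ i ∈ I, X i) ^ 2 * approxF N c g I
      - PowerSeries.coeff g (pointedSeries (fun i => (X i : R n)) (C c) I)
      ∈ idealOfVars (Fin n) ℚ ^ N := by
  have hC : (C c : R n) ^ 2 = 1 := by rw [← map_pow, hc, map_one]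
  rw [approxF]
  split_ifs with h1 h2
  · obtain ⟨rfl, h⟩ := h1
    rw [Finset.card_eq_zero] at h
    subst h
    simp [-PowerSeries.coeff_zero_eq_constantCoeff, coeff_zero_pointedSeries_empty, hC]
  · obtain ⟨rfl, h⟩ := h2
    obtain ⟨i, rfl⟩ := Finset.card_eq_one.1 h
    rw [coeff_zero_pointedSeries_singleton, Finset.sum_singleton]
    have hgeom := mul_neg_geom_sum (C (-c) * X i : R n) N
    have : (C c + X i) ^ 2 * (C c * ∑ k ∈ range N, (C (-c) * X i) ^ k) - (C c + X i)
        = -(C c + X i) * C (-c) ^ N * X i ^ N := by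
      rw [mul_assoc, ← mul_pow]
      simp only [map_neg] at hgeom ⊢
      linear_combination (C c + X i) * hgeom + (C c + X i) *
        (∑ k ∈ range N, (-C c * X i) ^ k) * hC
    rw [this]
    exact Ideal.mul_mem_left _ _ (Ideal.pow_mem_pow (Ideal.subset_span (Set.mem_range_self i)) N)
  · rw [sq_mul_stableF_withMarked _ _ (by omega), sub_self]
    exact zero_mem _

/-- The key cancellation for products `F(1, x_I) F(-1, x_J)`. -/
lemma sum_approxF_mul_mem (g n : ℕ) :
    (∑ I : Finset (Fin n), ∑ p ∈ antidiagonal g,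
      approxF (g + n) 1 p.1 I * approxF (g + n) (-1) p.2 Iᶜ : R n)
      ∈ idealOfVars (Fin n) ℚ ^ (g + n) := by
  set N := g + n with hN
  set q := Ideal.Quotient.mk (idealOfVars (Fin n) ℚ ^ N) with hq
  set S : R n := ∑ i, X i with hS
  set φ : Polynomial (R n) := (∑ k ∈ range N, (-Polynomial.X) ^ k) ^ 2 *
    (∑ k ∈ range N, (Polynomial.C S - Polynomial.X) ^ k) ^ 2 with hφ
  have hpow : ∀ I : Finset (Fin n), q (∑ i ∈ I, X i) ^ N = 0 := fun I => by
    rw [← map_pow, hq, Ideal.Quotient.eq_zero_iff_mem]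
    exact Ideal.pow_mem_pow (sum_X_mem I) N
  have hunit : ∀ I : Finset (Fin n), q (φ.eval (∑ i ∈ I, X i)) *
      (q ((C 1 + ∑ i ∈ I, X i) ^ 2) * q ((C (-1) + ∑ i ∈ Iᶜ, X i) ^ 2)) = 1 := by
    intro I
    have hc : S - ∑ i ∈ I, X i = ∑ i ∈ Iᶜ, X i := by
      rw [hS, ← Finset.sum_add_sum_compl I, add_sub_cancel_left]
    have h1 := mul_neg_geom_sum (-q (∑ i ∈ I, X i)) N
    have h2 := mul_neg_geom_sum (q (∑ i ∈ Iᶜ, X i)) N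
    have hpow' : (-q (∑ i ∈ I, X i)) ^ N = 0 := by
      rw [← map_neg, ← map_pow, hq, Ideal.Quotient.eq_zero_iff_mem]
      exact Ideal.pow_mem_pow (neg_mem (sum_X_mem I)) N
    rw [hpow', sub_zero] at h1
    rw [hpow, sub_zero] at h2
    simp only [hφ, Polynomial.eval_mul, Polynomial.eval_pow, Polynomial.eval_finsetSum,
      Polynomial.eval_sub, Polynomial.eval_neg, Polynomial.eval_C, Polynomial.eval_X, hc, map_mul,
      map_pow, map_add, map_neg, map_one]
    simp only [map_sum q (fun k => (-∑ i ∈ I, X i : R n) ^ k),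
      map_sum q (fun k => (∑ i ∈ Iᶜ, X i : R n) ^ k), map_pow, map_neg]
    set a := ∑ k ∈ range N, (-q (∑ i ∈ I, X i)) ^ k
    set b := ∑ k ∈ range N, q (∑ i ∈ Iᶜ, X i) ^ k
    calc _ = ((1 - -q (∑ i ∈ I, X i)) * a) ^ 2 * ((1 - q (∑ i ∈ Iᶜ, X i)) * b) ^ 2 := by ring
      _ = 1 := by rw [h1, h2]; ring
  have happ : ∀ (c : ℚ), c ^ 2 = 1 → ∀ h I, q (PowerSeries.coeff h (pointedSeries
      (fun i => (X i : R n)) (C c) I)) = q ((C c + ∑ i ∈ I, X i) ^ 2) * q (approxF N c h I) := by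
    intro c hc h I
    rw [← map_mul, eq_comm, hq, Ideal.Quotient.eq]
    exact sq_mul_approxF_sub_mem N hc h I
  have hmem := coeff_pairSum_mem (isIdealFiltration_varFiltration n) (x := fun i => (X i : R n))
    (y := C 1)
    (fun i => by
      simpa [varFiltration] using (Ideal.subset_span ⟨i, rfl⟩ : (X i : R n) ∈ idealOfVars (Fin n) ℚ))
    (pointedSeries_pointedEq _ _) (by rw [← map_neg]; exact pointedSeries_pointedEq _ (C (-1)))
    univ φ g
  have hNint : ((g : ℤ) + ((univ : Finset (Fin n)).card : ℤ)).toNat = N := by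
    rw [card_univ, Fintype.card_fin]; omega
  rw [varFiltration, hNint, ← Ideal.Quotient.eq_zero_iff_mem, pairSum, map_sum, powerset_univ,
    map_sum] at hmem
  rw [← Ideal.Quotient.eq_zero_iff_mem, ← hmem, map_sum]
  refine Finset.sum_congr rfl fun I _ => ?_
  rw [PowerSeries.coeff_C_mul, PowerSeries.coeff_mul, map_mul, map_sum, map_sum, Finset.mul_sum]
  refine Finset.sum_congr rfl fun p _ => ?_
  rw [map_mul, map_mul, ← hq, happ 1 (by norm_num), ← Finset.compl_eq_univ_sdiff,
    happ (-1) (by norm_num)]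
  linear_combination (-q (approxF N 1 p.1 I) * q (approxF N (-1) p.2 Iᶜ)) * hunit I

end Truncation

section Coefficients

variable {n : ℕ}

/-- The exponents `d_i` for `i ∈ I`, and zero elsewhere. -/
def restrictExp (d : Fin n → ℕ) (I : Finset (Fin n)) : Fin n →₀ ℕ :=
  (Finsupp.equivFunOnFinite.symm d).filter (· ∈ I)

lemma restrictExp_apply (d : Fin n → ℕ) (I : Finset (Fin n)) (i : Fin n) :
    restrictExp d I i = if i ∈ I then d i else 0 := by
  simp [restrictExp, Finsupp.filter_apply]

/-- A polynomial involving only the variables of `I`. -/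
def InVars (I : Finset (Fin n)) (f : R n) : Prop :=
  ∀ e : Fin n →₀ ℕ, coeff e f ≠ 0 → ∀ i ∉ I, e i = 0

lemma coeff_mul_of_inVars {I : Finset (Fin n)} {f h : R n} (hf : InVars I f) (hh : InVars Iᶜ h)
    (d : Fin n → ℕ) : coeff (Finsupp.equivFunOnFinite.symm d) (f * h)
      = coeff (restrictExp d I) f * coeff (restrictExp d Iᶜ) h := by
  rw [coeff_mul]
  refine Finset.sum_eq_single (restrictExp d I, restrictExp d Iᶜ) ?_ ?_
  · rintro ⟨a, b⟩ hab hne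
    rw [HasAntidiagonal.mem_antidiagonal] at hab
    by_contra h0
    have ha := hf a (left_ne_zero_of_mul h0)
    have hb := hh b (right_ne_zero_of_mul h0)
    have hi : ∀ i, a i + b i = d i := fun i => by
      simpa using DFunLike.congr_fun hab i
    apply hne
    ext i
    · rw [restrictExp_apply]
      split_ifs with h
      · have := hb i (by simpa using h)
        have := hi i
        change a i = d i
        omega
      · exact ha i h
    · rw [restrictExp_apply]
      split_ifs with h
      · have := ha i (by simpa using h)
        have := hi i
        change b i = d i
        omega
      · exact hb i h
  · intro h
    exfalso
    apply h
    rw [HasAntidiagonal.mem_antidiagonal]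
    ext i
    simp only [Finsupp.add_apply, restrictExp_apply, Finset.mem_compl,
      Finsupp.equivFunOnFinite_symm_apply_apply]
    split_ifs <;> simp

lemma coeff_stableF_withMarked (c : ℚ) (I : Finset (Fin n)) (g : ℕ) (m : Fin n →₀ ℕ) :
    coeff m (stableF (withMarked (C c) fun i => (X i : R n)) (insertNone I) g)
      = ∑ k ∈ (npointPoly (I.card + 1) g).support, coeff k (npointPoly (I.card + 1) g) *
          (c ^ k 0 * if k.tail.mapDomain (I.orderEmbOfFin rfl) = m then 1 else 0) := by
  set e : Fin (I.card + 1) ↪ Option (Fin n) :=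
    ⟨Fin.cons none fun i => some (I.orderEmbOfFin rfl i),
      cons_orderEmbOfFin_injective I none (Option.some_injective _) fun i _ => Option.some_ne_none i⟩
    with he
  have hmap : (univ : Finset (Fin (I.card + 1))).map e = insertNone I := by
    apply Finset.eq_of_subset_of_card_le
    · intro o ho
      obtain ⟨i, -, rfl⟩ := Finset.mem_map.1 ho
      refine Fin.cases ?_ (fun i => ?_) i
      · exact Finset.none_mem_insertNone
      · exact Finset.some_mem_insertNone.2 (I.orderEmbOfFin_mem rfl i)
    · simp
  have h1 : stableF (withMarked (C c) fun i => (X i : R n)) (insertNone I) g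
      = aeval (fun i => withMarked (C c) (fun i => (X i : R n)) (e i)) (npointPoly (I.card + 1) g) := by
    rw [← hmap, ← stableF_comp]
    have := map_stableF (aeval (fun i => withMarked (C c) (fun i => (X i : R n)) (e i)) :
      R (I.card + 1) →ₐ[ℚ] R n).toRingHom (fun i : Fin (I.card + 1) => (X i : R _)) univ g
    simp only [AlgHom.toRingHom_eq_coe, RingHom.coe_coe, aeval_X] at this
    exact this.symm
  rw [h1, aeval_def, eval₂_eq', coeff_sum]
  refine Finset.sum_congr rfl fun k _ => ?_
  have h2 : ∏ i, withMarked (C c) (fun i => (X i : R n)) (e i) ^ k i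
      = C (c ^ k 0) * monomial (k.tail.mapDomain (I.orderEmbOfFin rfl)) 1 := by
    rw [Fin.prod_univ_succ, ← rename_monomial, monomial_eq, Finsupp.prod_fintype _ _ (by simp)]
    simp [he, withMarked, Finsupp.tail_apply]
  rw [h2, algebraMap_eq, coeff_C_mul, coeff_C_mul, coeff_monomial]

lemma mapDomain_eq_restrictExp_iff (d : Fin n → ℕ) (I : Finset (Fin n)) (t : Fin I.card →₀ ℕ) :
    t.mapDomain (I.orderEmbOfFin rfl) = restrictExp d I
      ↔ ∀ i, t i = d (I.orderEmbOfFin rfl i) := by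
  have hinj := (I.orderEmbOfFin rfl).injective
  constructor
  · intro h i
    have := DFunLike.congr_fun h (I.orderEmbOfFin rfl i)
    rwa [Finsupp.mapDomain_apply hinj, restrictExp_apply,
      if_pos (I.orderEmbOfFin_mem rfl i)] at this
  · intro h
    ext i
    rw [restrictExp_apply]
    split_ifs with hi
    · obtain ⟨j, rfl⟩ : i ∈ Set.range (I.orderEmbOfFin rfl) := by
        rw [Finset.range_orderEmbOfFin]; exact hi
      rw [Finsupp.mapDomain_apply hinj, h]
    · refine Finsupp.mapDomain_of_notMem_range _ _ ?_
      rw [Finset.range_orderEmbOfFin]; exact hi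

lemma inVars_stableF_withMarked (c : ℚ) (I : Finset (Fin n)) (g : ℕ) :
    InVars I (stableF (withMarked (C c) fun i => (X i : R n)) (insertNone I) g) := by
  intro m hm i hi
  rw [coeff_stableF_withMarked] at hm
  obtain ⟨k, -, hk⟩ := Finset.exists_ne_zero_of_sum_ne_zero hm
  split_ifs at hk with h
  · rw [← h]
    refine Finsupp.mapDomain_of_notMem_range _ _ ?_
    rw [Finset.range_orderEmbOfFin]; exact hi
  · simp at hk

lemma coeff_restrictExp_stableF (c : ℚ) {I : Finset (Fin n)} {g : ℕ} (hI : 1 < 2 * g + I.card)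
    (d : Fin n → ℕ) {j : ℕ} (hj : j + ∑ i ∈ I, d i + 2 = 3 * g + I.card) :
    coeff (restrictExp d I) (stableF (withMarked (C c) fun i => (X i : R n)) (insertNone I) g)
      = c ^ j * bracketI g j I d := by
  have hb : bracketI g j I d = coeff (Finsupp.equivFunOnFinite.symm
      (Fin.cons j fun i => d (I.orderEmbOfFin rfl i))) (npointPoly (I.card + 1) g) :=
    bracket_eq_coeff (Nat.succ_ne_zero _) (by omega) _
  rw [coeff_stableF_withMarked, hb]
  set k₀ : Fin (I.card + 1) →₀ ℕ :=
    Finsupp.equivFunOnFinite.symm (Fin.cons j fun i => d (I.orderEmbOfFin rfl i)) with hk₀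
  rw [Finset.sum_eq_single k₀]
  · have ht : k₀.tail.mapDomain (I.orderEmbOfFin rfl) = restrictExp d I := by
      rw [mapDomain_eq_restrictExp_iff]
      intro i
      simp [hk₀, Finsupp.tail_apply]
    rw [if_pos ht, mul_one, mul_comm]
    simp [hk₀]
  · intro k hk hne
    rw [if_neg, mul_zero, mul_zero]
    rw [mapDomain_eq_restrictExp_iff]
    intro h
    apply hne
    have hdeg : ∑ i, k i + 3 = 3 * g + (I.card + 1) := by
      by_contra h0
      exact (mem_support_iff.1 hk) (coeff_npointPoly_eq_zero h0)
    have hs := sum_orderEmbOfFin I d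
    simp only [Finsupp.tail_apply] at h
    rw [Fin.sum_univ_succ] at hdeg
    simp only [h] at hdeg
    ext i
    refine Fin.cases ?_ (fun i => ?_) i
    · simp only [hk₀, Finsupp.equivFunOnFinite_symm_apply_apply, Fin.cons_zero]
      omega
    · simp [hk₀, h]
  · intro h
    rw [notMem_support_iff.1 h, zero_mul]

lemma coeff_restrictExp_stableF_eq_zero (c : ℚ) {I : Finset (Fin n)} {g : ℕ} (d : Fin n → ℕ)
    (hI : 3 * g + I.card < ∑ i ∈ I, d i + 2) :
    coeff (restrictExp d I) (stableF (withMarked (C c) fun i => (X i : R n)) (insertNone I) g)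
      = 0 := by
  rw [coeff_stableF_withMarked]
  refine Finset.sum_eq_zero fun k hk => ?_
  rw [if_neg, mul_zero, mul_zero]
  rw [mapDomain_eq_restrictExp_iff]
  intro h
  have hdeg : ∑ i, k i + 3 = 3 * g + (I.card + 1) := by
    by_contra h0
    exact (mem_support_iff.1 hk) (coeff_npointPoly_eq_zero h0)
  have hs := sum_orderEmbOfFin I d
  simp only [Finsupp.tail_apply] at h
  rw [Fin.sum_univ_succ] at hdeg
  simp only [h] at hdeg
  omega

lemma approxF_empty (N : ℕ) (c : ℚ) : approxF N c 0 (∅ : Finset (Fin n)) = 1 := by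
  simp [approxF]

lemma approxF_singleton (N : ℕ) (c : ℚ) (i : Fin n) :
    approxF N c 0 {i} = ∑ k ∈ range N, monomial (Finsupp.single i k) (c * (-c) ^ k) := by
  rw [approxF, if_neg (by simp), if_pos (by simp), Finset.mul_sum]
  refine Finset.sum_congr rfl fun k _ => ?_
  rw [Finset.sum_singleton, mul_pow, ← map_pow, ← mul_assoc, ← map_mul, C_mul_X_pow_eq_monomial]

lemma approxF_of_lt (N : ℕ) (c : ℚ) {g : ℕ} {I : Finset (Fin n)} (h : 1 < 2 * g + I.card) :
    approxF N c g I = stableF (withMarked (C c) fun i => (X i : R n)) (insertNone I) g := by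
  rw [approxF, if_neg (by omega), if_neg (by omega)]

lemma inVars_approxF (N : ℕ) (c : ℚ) (g : ℕ) (I : Finset (Fin n)) : InVars I (approxF N c g I) := by
  by_cases h : 1 < 2 * g + I.card
  · rw [approxF_of_lt N c h]; exact inVars_stableF_withMarked c I g
  obtain rfl : g = 0 := by omega
  rcases Finset.eq_empty_or_nonempty I with rfl | hI
  · intro e he i _
    rw [approxF_empty, coeff_one] at he
    have : 0 = e := by by_contra h0; simp [h0] at he
    rw [← this]; rfl
  · obtain ⟨i, rfl⟩ := Finset.card_eq_one.1 (show I.card = 1 by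
      have := Finset.card_pos.2 hI; omega)
    intro e he j hj
    rw [approxF_singleton, coeff_sum] at he
    obtain ⟨k, -, hk⟩ := Finset.exists_ne_zero_of_sum_ne_zero he
    rw [coeff_monomial] at hk
    have : Finsupp.single i k = e := by by_contra h0; simp [h0] at hk
    rw [← this, Finsupp.single_eq_of_ne (by simpa using hj)]

lemma coeff_approxF_empty (N : ℕ) (c : ℚ) (d : Fin n → ℕ) :
    coeff (restrictExp d ∅) (approxF N c 0 ∅) = 1 := by
  have : restrictExp d ∅ = 0 := by ext i; simp [restrictExp_apply]
  rw [approxF_empty, this, coeff_zero_one]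

lemma coeff_approxF_singleton {N : ℕ} (c : ℚ) {d : Fin n → ℕ} {i : Fin n} (h : d i < N) :
    coeff (restrictExp d {i}) (approxF N c 0 {i}) = c * (-c) ^ d i := by
  have : restrictExp d {i} = Finsupp.single i (d i) := by
    ext j
    rw [restrictExp_apply, Finsupp.single_apply]
    by_cases hj : j = i
    · subst hj; simp
    · rw [if_neg (by simpa using hj), if_neg (Ne.symm hj)]
  rw [approxF_singleton, this, coeff_sum, Finset.sum_eq_single (d i)]
  · rw [coeff_monomial, if_pos rfl]
  · intro k _ hk
    rw [coeff_monomial, if_neg fun h => hk (Finsupp.single_injective i h)]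
  · intro h'; simp at h'; omega

end Coefficients

section Assembly

variable {n : ℕ}

lemma bracketI_zero_of_card_le_one {I : Finset (Fin n)} (hI : I.card ≤ 1) (j : ℕ)
    (d : Fin n → ℕ) : bracketI 0 j I d = 0 := by
  rw [bracketI, bracket, if_pos ⟨rfl, by omega⟩]

/-- The alternating sum of products of intersection indices attached to `g = h + h'` and to
`{1,…,n} = I ⊔ Iᶜ`. -/
def alternatingSum (h h' : ℕ) (I : Finset (Fin n)) (d : Fin n → ℕ) : ℚ :=
  ∑ j ∈ range (2 * (h + h') - 1),
    (-1 : ℚ) ^ j * bracketI h j I d * bracketI h' (2 * (h + h') - 2 - j) Iᶜ d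

/-- The contribution of the unstable terms `F_0(x_I)`, `|I| ≤ 1`. -/
def unstableTerm (g : ℕ) (I : Finset (Fin n)) (d : Fin n → ℕ) : ℚ :=
  (if I = ∅ then bracket g (Fin.cons (2 * g) d : Fin (n + 1) → ℕ) else 0)
    - ∑ i, if I = {i} then bracket g (Function.update d i (d i + 2 * g - 1)) else 0

lemma unstableTerm_empty (g : ℕ) (d : Fin n → ℕ) :
    unstableTerm g ∅ d = bracket g (Fin.cons (2 * g) d : Fin (n + 1) → ℕ) := by
  simp [unstableTerm, (Finset.singleton_ne_empty _).symm]

lemma unstableTerm_singleton (g : ℕ) (i : Fin n) (d : Fin n → ℕ) :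
    unstableTerm g {i} d = -bracket g (Function.update d i (d i + 2 * g - 1)) := by
  simp [unstableTerm]

lemma unstableTerm_of_one_lt {g : ℕ} {I : Finset (Fin n)} (hI : 1 < I.card) (d : Fin n → ℕ) :
    unstableTerm g I d = 0 := by
  rw [unstableTerm, if_neg (by rintro rfl; simp at hI), zero_sub, neg_eq_zero]
  exact Finset.sum_eq_zero fun i _ => if_neg (by rintro rfl; simp at hI)

lemma sum_unstableTerm (g : ℕ) (d : Fin n → ℕ) : ∑ I, unstableTerm g I d
    = bracket g (Fin.cons (2 * g) d : Fin (n + 1) → ℕ)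
      - ∑ i, bracket g (Function.update d i (d i + 2 * g - 1)) := by
  simp only [unstableTerm, Finset.sum_sub_distrib]
  rw [Finset.sum_comm (s := (univ : Finset (Finset (Fin n))))]
  simp

lemma sum_unstableTerm_compl (g : ℕ) (d : Fin n → ℕ) :
    ∑ I : Finset (Fin n), unstableTerm g Iᶜ d = ∑ I, unstableTerm g I d :=
  Equiv.sum_comp (Equiv.mk compl compl compl_compl compl_compl) fun I => unstableTerm g I d

lemma card_add_card_compl' (I : Finset (Fin n)) : I.card + Iᶜ.card = n := by
  rw [Finset.card_add_card_compl, Fintype.card_fin]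

lemma coeff_mul_coeff_of_card_le_one {h : ℕ} (hh : 1 ≤ h) {N : ℕ} {c : ℚ} (hc : c ^ 2 = 1)
    {I : Finset (Fin n)} (hI : I.card ≤ 1) {d : Fin n → ℕ} (hsum : ∑ i, d i + 2 = h + n)
    (hN : ∀ i, d i < N) :
    coeff (restrictExp d I) (approxF N c 0 I) * coeff (restrictExp d Iᶜ) (approxF N (-c) h Iᶜ)
      = unstableTerm h I d := by
  have hcard := card_add_card_compl' I
  have hs := Finset.sum_add_sum_compl I d
  rcases Finset.eq_empty_or_nonempty I with rfl | hne
  · simp only [Finset.sum_empty, Finset.card_empty] at hs hcard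
    rw [coeff_approxF_empty, approxF_of_lt _ _ (by omega),
      coeff_restrictExp_stableF (j := 2 * h) _ (by omega) d (by omega), pow_mul, neg_sq, hc,
      one_pow, one_mul, one_mul, Finset.compl_empty, bracketI_univ, unstableTerm_empty]
  · obtain ⟨i, rfl⟩ := Finset.card_eq_one.1 (le_antisymm hI (Finset.card_pos.2 hne))
    simp only [Finset.sum_singleton, Finset.card_singleton] at hs hcard
    rw [coeff_approxF_singleton c (hN i), approxF_of_lt _ _ (by omega),
      coeff_restrictExp_stableF (j := d i + 2 * h - 1) _ (by omega) d (by omega),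
      bracketI_compl_singleton, unstableTerm_singleton, ← mul_assoc]
    obtain ⟨k, rfl⟩ := Nat.exists_eq_add_of_le' hh
    rw [show d i + 2 * (k + 1) - 1 = d i + 2 * k + 1 by omega, pow_succ, pow_add, pow_mul, neg_sq,
      hc, one_pow]
    have h2 : (-c) ^ d i * (-c) ^ d i = 1 := by rw [← mul_pow, neg_mul_neg, ← sq, hc, one_pow]
    linear_combination (-(c ^ 2) * h2 - hc) * bracket (k + 1) (Function.update d i (d i + 2 * k + 1))

lemma coeff_mul_coeff_of_one_lt {h h' : ℕ} (N : ℕ) {I : Finset (Fin n)} (hI : 1 < 2 * h + I.card)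
    (hI' : 1 < 2 * h' + Iᶜ.card) {d : Fin n → ℕ} (hsum : ∑ i, d i + 2 = h + h' + n)
    (hg : 1 ≤ h + h') :
    coeff (restrictExp d I) (approxF N 1 h I) * coeff (restrictExp d Iᶜ) (approxF N (-1) h' Iᶜ)
      = alternatingSum h h' I d := by
  have hcard := card_add_card_compl' I
  have hs := Finset.sum_add_sum_compl I d
  rw [approxF_of_lt _ _ hI, approxF_of_lt _ _ hI', alternatingSum]
  by_cases h1 : 3 * h + I.card < ∑ i ∈ I, d i + 2
  · rw [coeff_restrictExp_stableF_eq_zero _ _ h1, zero_mul, eq_comm]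
    refine Finset.sum_eq_zero fun j _ => ?_
    rw [bracketI_eq_zero_of_sum_ne (g := h) (by omega), mul_zero, zero_mul]
  by_cases h2 : 3 * h' + Iᶜ.card < ∑ i ∈ Iᶜ, d i + 2
  · rw [coeff_restrictExp_stableF_eq_zero _ _ h2, mul_zero, eq_comm]
    refine Finset.sum_eq_zero fun j _ => ?_
    rw [bracketI_eq_zero_of_sum_ne (g := h') (by omega), mul_zero]
  obtain ⟨j, hj⟩ := Nat.exists_eq_add_of_le' (not_lt.1 h1)
  obtain ⟨j', hj'⟩ := Nat.exists_eq_add_of_le' (not_lt.1 h2)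
  rw [coeff_restrictExp_stableF (j := j) _ hI d (by omega),
    coeff_restrictExp_stableF (j := j') _ hI' d (by omega), Finset.sum_eq_single j]
  · rw [show 2 * (h + h') - 2 - j = j' by omega, one_pow]
    have : (-1 : ℚ) ^ j = (-1) ^ j' := by
      rw [neg_one_pow_eq_pow_mod_two, neg_one_pow_eq_pow_mod_two (n := j'),
        show j % 2 = j' % 2 by omega]
    rw [this]
    ring
  · intro k _ hk
    rw [bracketI_eq_zero_of_sum_ne (g := h) (by omega), mul_zero, zero_mul]
  · intro hk
    rw [Finset.mem_range] at hk
    omega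

lemma alternatingSum_zero_left {h' : ℕ} {I : Finset (Fin n)} (hI : I.card ≤ 1) (d : Fin n → ℕ) :
    alternatingSum 0 h' I d = 0 :=
  Finset.sum_eq_zero fun j _ => by rw [bracketI_zero_of_card_le_one hI, mul_zero, zero_mul]

lemma alternatingSum_zero_right {h : ℕ} {I : Finset (Fin n)} (hI : Iᶜ.card ≤ 1) (d : Fin n → ℕ) :
    alternatingSum h 0 I d = 0 :=
  Finset.sum_eq_zero fun j _ => by rw [bracketI_zero_of_card_le_one hI, mul_zero]

lemma coeff_mul_coeff_approxF {g h h' : ℕ} (hg : 1 ≤ g) (hh : h + h' = g) (I : Finset (Fin n))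
    {d : Fin n → ℕ} (hsum : ∑ i, d i + 2 = g + n) :
    coeff (restrictExp d I) (approxF (g + n) 1 h I)
        * coeff (restrictExp d Iᶜ) (approxF (g + n) (-1) h' Iᶜ)
      = alternatingSum h h' I d + (if h = 0 then unstableTerm g I d else 0)
        + if h' = 0 then unstableTerm g Iᶜ d else 0 := by
  have hN : ∀ i, d i < g + n := fun i => by
    have := Finset.single_le_sum (fun i _ => Nat.zero_le (d i)) (Finset.mem_univ i)
    omega
  subst hh
  by_cases h1 : 2 * h + I.card ≤ 1
  · obtain rfl : h = 0 := by omega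
    rw [zero_add] at *
    rw [coeff_mul_coeff_of_card_le_one hg (by norm_num) (by omega) hsum hN,
      alternatingSum_zero_left (by omega), if_pos rfl, if_neg (by omega)]
    ring
  by_cases h2 : 2 * h' + Iᶜ.card ≤ 1
  · obtain rfl : h' = 0 := by omega
    rw [add_zero] at *
    have := coeff_mul_coeff_of_card_le_one hg (c := -1) (by norm_num) (I := Iᶜ) (by omega) hsum hN
    rw [compl_compl, neg_neg, mul_comm] at this
    rw [this, alternatingSum_zero_right (by omega), if_neg (by omega), if_pos rfl]
    ring
  rw [coeff_mul_coeff_of_one_lt _ (by omega) (by omega) hsum hg]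
  have e1 : (if h = 0 then unstableTerm (h + h') I d else 0) = 0 := by
    split_ifs
    · exact unstableTerm_of_one_lt (by omega) d
    · rfl
  have e2 : (if h' = 0 then unstableTerm (h + h') Iᶜ d else 0) = 0 := by
    split_ifs
    · exact unstableTerm_of_one_lt (by omega) d
    · rfl
  rw [e1, e2, add_zero, add_zero]

lemma sum_coeff_mul_coeff_approxF {g : ℕ} {d : Fin n → ℕ} (hsum : ∑ i, d i < g + n) :
    ∑ I : Finset (Fin n), ∑ p ∈ antidiagonal g,
      coeff (restrictExp d I) (approxF (g + n) 1 p.1 I)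
        * coeff (restrictExp d Iᶜ) (approxF (g + n) (-1) p.2 Iᶜ) = 0 := by
  have h := (mem_pow_idealOfVars_iff' (g + n) _).1 (sum_approxF_mul_mem g n)
    (Finsupp.equivFunOnFinite.symm d) (by simpa [Finsupp.degree_eq_sum] using hsum)
  simpa only [coeff_sum, coeff_mul_of_inVars (inVars_approxF _ _ _ _) (inVars_approxF _ _ _ _)]
    using h

end Assembly

/-- Corollary 3.2 (i): for `g ≥ 1`, `d_j ≥ 0` with `Σ d_j = g + n − 2`,
`⟨τ_{2g}Πτ_{d_j}⟩_g = Σ_j ⟨τ_{d_j+2g−1}Π_{i≠j}τ_{d_i}⟩_g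
 − ½ Σ_{g'} Σ_{I⊔J} Σ_{j=0}^{2g−2} (−1)^j ⟨τ_jΠ_{i∈I}τ_{d_i}⟩_{g'}⟨τ_{2g−2−j}Π_{i∈J}τ_{d_i}⟩_{g−g'}`. -/
theorem corollary_3_2_i (g n : ℕ) (hg : 1 ≤ g) (hn : 1 ≤ n) (d : Fin n → ℕ)
    (hsum : ∑ j, d j = g + n - 2) :
    bracket g (Fin.cons (2*g) d)
      = ∑ j, bracket g (Function.update d j (d j + 2*g - 1))
        - (1/2) * ∑ gp ∈ Finset.range (g+1), ∑ I : Finset (Fin n),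
            ∑ j ∈ Finset.range (2*g-1),
              (-1 : ℚ)^j * bracketI gp j I d * bracketI (g-gp) (2*g-2-j) Iᶜ d := by
  have hsum' : ∑ i, d i + 2 = g + n := by omega
  have key := sum_coeff_mul_coeff_approxF (g := g) (d := d) (by omega)
  rw [Finset.sum_comm] at key
  have hpair : ∀ p ∈ antidiagonal g, ∑ I : Finset (Fin n),
      coeff (restrictExp d I) (approxF (g + n) 1 p.1 I)
        * coeff (restrictExp d Iᶜ) (approxF (g + n) (-1) p.2 Iᶜ)
      = ∑ I : Finset (Fin n), alternatingSum p.1 p.2 I d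
        + (if p = (0, g) then ∑ I, unstableTerm g I d else 0)
        + if p = (g, 0) then ∑ I, unstableTerm g I d else 0 := by
    rintro ⟨h, h'⟩ hp
    rw [HasAntidiagonal.mem_antidiagonal] at hp
    have e1 : ((h, h') = (0, g)) = (h = 0) := by
      simp only [Prod.mk.injEq, eq_iff_iff] at hp ⊢; omega
    have e2 : ((h, h') = (g, 0)) = (h' = 0) := by
      simp only [Prod.mk.injEq, eq_iff_iff] at hp ⊢; omega
    simp only [coeff_mul_coeff_approxF hg hp _ hsum', Finset.sum_add_distrib, e1, e2]
    congr 1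
    · congr 1
      split_ifs <;> simp
    · split_ifs
      · exact sum_unstableTerm_compl g d
      · simp
  rw [Finset.sum_congr rfl hpair, Finset.sum_add_distrib, Finset.sum_add_distrib,
    Finset.sum_ite_eq', Finset.sum_ite_eq', if_pos (by simp), if_pos (by simp),
    sum_unstableTerm, Finset.Nat.sum_antidiagonal_eq_sum_range_succ_mk] at key
  have hB : ∀ gp ∈ range (g + 1), ∑ I : Finset (Fin n), alternatingSum gp (g - gp) I d
      = ∑ I : Finset (Fin n), ∑ j ∈ Finset.range (2*g-1),
        (-1 : ℚ)^j * bracketI gp j I d * bracketI (g-gp) (2*g-2-j) Iᶜ d := by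
    intro gp hgp
    rw [Finset.mem_range] at hgp
    simp only [alternatingSum, show gp + (g - gp) = g by omega]
  rw [← Finset.sum_congr rfl hB]
  linarith

end
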